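/- arXiv:1101.3376 — 10 statements merged into one kernel-verified Lean document; each statement's English description precedes it below -/
import Mathlib

section
/- Let q be a prime power, G a finite group, and V a finite, faithful, irreducible GF(q)G-module. Suppose V is induced from a submodule W such that, for H = N_G(W) (the stabilizer of W in G), the group H/C_G(W) is isomorphic, as a group of GF(q)-linear transformations of W, to an (irreducible) subgroup of the semilinear group Γ(W) (where W is identified with the field GF(q^{dim W})). Let N = ⋂_{g∈G} H^g ⊴ G and assume |N| is odd. If N has an r-regular orbit on V for every prime number r, then N has a regular orbit on V. -/
open Pointwise

/-- If an endomorphism `α` with `α ^ r = 1` at `y` fixes `s = α y / y`, then `s ^ r = 1`. -/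
theorem pow_eq_one_of_map_div {Y : Type*} [CommGroup Y] (α : Y →* Y) {r : ℕ} {y s : Y}
    (hr : α^[r] y = y) (hs : α y / y = s) (hfix : α s = s) : s ^ r = 1 := by
  have key : ∀ k : ℕ, α^[k] y = y * s ^ k := by
    intro k
    induction k with
    | zero => simp
    | succ k ih =>
      rw [Function.iterate_succ_apply', ih, map_mul, map_pow, hfix, pow_succ, ← hs]
      rw [mul_comm ((α y / y) ^ k), ← mul_assoc, mul_div_cancel]
  have := key r
  rw [hr] at this
  exact left_eq_mul.mp this

/-- In a finite abelian group the `p`-components of an element can be prescribed independently. -/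
theorem exists_pow_ordCompl_div_eq_one {Y : Type*} [CommGroup Y] [Finite Y] (w : ℕ → Y) :
    ∃ u : Y, ∀ p : ℕ, p.Prime →
      (u / w p) ^ (Nat.card Y / p ^ (Nat.card Y).factorization p) = 1 := by
  classical
  set n := Nat.card Y with hn
  have hn0 : n ≠ 0 := Nat.card_pos.ne'
  have hcop : ∀ p : ℕ, p.Prime → (p ^ n.factorization p).Coprime (n / p ^ n.factorization p) :=
    fun p hp => (Nat.coprime_ordCompl hp hn0).pow_left _
  have hN : ∀ p : ℕ, ∃ N : ℕ, p.Prime →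
      N ≡ 1 [MOD p ^ n.factorization p] ∧ N ≡ 0 [MOD n / p ^ n.factorization p] := by
    intro p
    by_cases hp : p.Prime
    · exact ⟨_, fun _ => (Nat.chineseRemainder (hcop p hp) 1 0).2⟩
    · exact ⟨0, fun h => absurd h hp⟩
  choose N hN using hN
  have hpow : ∀ (y : Y) (k : ℕ), n ∣ k → y ^ k = 1 := by
    rintro y k ⟨c, rfl⟩
    rw [pow_mul, hn, pow_card_eq_one', one_pow]
  refine ⟨∏ p ∈ n.primeFactors, w p ^ N p, fun p hp => ?_⟩
  by_cases hpn : p ∈ n.primeFactors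
  · rw [← Finset.mul_prod_erase _ _ hpn, div_pow, mul_pow, ← Finset.prod_pow]
    rw [Finset.prod_eq_one, mul_one, div_eq_one, ← pow_mul]
    · rw [pow_eq_pow_iff_modEq]
      refine Nat.ModEq.of_dvd (orderOf_dvd_natCard _) ?_
      have := (hN p hp).1.mul_right' (n / p ^ n.factorization p)
      rwa [Nat.ordProj_mul_ordCompl_eq_self, one_mul] at this
    · intro q hq
      have hqp := Finset.ne_of_mem_erase hq
      have hq' := Nat.prime_of_mem_primeFactors (Finset.mem_of_mem_erase hq)
      rw [← pow_mul]
      apply hpow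
      have h1 : p ^ n.factorization p ∣ N q := by
        refine dvd_trans ?_ ((Nat.modEq_zero_iff_dvd).1 (hN q hq').2)
        refine Nat.Coprime.dvd_of_dvd_mul_left (k := p ^ n.factorization p)
          (m := q ^ n.factorization q) ?_ ?_
        · exact Nat.Coprime.pow _ _ ((Nat.coprime_primes hp hq').2 hqp.symm)
        · rw [Nat.ordProj_mul_ordCompl_eq_self]
          exact Nat.ordProj_dvd n p
      conv_lhs => rw [← Nat.ordProj_mul_ordCompl_eq_self n p]
      exact Nat.mul_dvd_mul h1 dvd_rfl
  · apply hpow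
    have : n.factorization p = 0 := by
      rw [← Finsupp.notMem_support_iff]
      simpa using hpn
    simp [this]

/-- Commuting affine maps of a finite abelian group: given points `y r`, there is a point `u`
such that for every prime `r` each of the maps of order dividing `r` that fixes `u` also fixes
`y r`. -/
theorem exists_fixed_imp_fixed_of_affine {Y ι : Type*} [CommGroup Y] [Finite Y]
    (f : ι → Y → Y) (α : ι → Y →* Y) (hf : ∀ i y z, f i (y * z) = f i y * α i z)
    (hcomm : ∀ i j y, f i (f j y) = f j (f i y)) (y : ℕ → Y) :
    ∃ u : Y, ∀ (i : ι) (r : ℕ), r.Prime → (∀ z, (f i)^[r] z = z) → f i u = u →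
      f i (y r) = y r := by
  classical
  set n := Nat.card Y with hn
  have hn0 : n ≠ 0 := Nat.card_pos.ne'
  let m : ℕ → ℕ := fun p => n / p ^ n.factorization p
  have hαcomm : ∀ i j z, α i (α j z) = α j (α i z) := by
    intro i j z
    have h := hcomm i j (1 * z)
    rw [hf, hf, hf, hf, hcomm] at h
    exact mul_left_cancel h
  have hαiter : ∀ i (r : ℕ), (∀ z, (f i)^[r] z = z) → ∀ z, (α i)^[r] z = z := by
    intro i r h z
    have key : ∀ k : ℕ, (f i)^[k] (1 * z) = (f i)^[k] 1 * (α i)^[k] z := by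
      intro k
      induction k with
      | zero => simp
      | succ k ih => rw [Function.iterate_succ_apply', ih, hf,
          Function.iterate_succ_apply', Function.iterate_succ_apply']
    have := key r
    rw [h, h] at this
    exact (mul_left_cancel this).symm
  let S : ℕ → Y → Set ι := fun p y => {i | (f i y / y) ^ m p = 1}
  have hmul : ∀ i a z, f i (a * z) / (a * z) = f i a / a * (α i z / z) := by
    intro i a z
    rw [hf, mul_div_mul_comm]
  have hmin : ∀ p : ℕ, ∃ u, S p u ⊆ S p (y p) ∧ ∀ u', S p u' ⊆ S p u → S p u ⊆ S p u' := by
    intro p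
    obtain ⟨u, hu, hu'⟩ := (Set.toFinite {u | S p u ⊆ S p (y p)}).exists_minimalFor (S p) _
      ⟨y p, Set.Subset.rfl⟩
    exact ⟨u, hu, fun u' h => hu' (h.trans hu) h⟩
  choose w hw hwmin using hmin
  have hone : ∀ {p k : ℕ}, p.Coprime k → ∀ {s t : Y}, s = t ^ m p → s ^ k = 1 → s = 1 := by
    intro p k hpk s t hst hsk
    have h1 : s ^ p ^ n.factorization p = 1 := by
      rw [hst, ← pow_mul, mul_comm, Nat.ordProj_mul_ordCompl_eq_self, hn, pow_card_eq_one']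
    have h2 := Nat.dvd_gcd (orderOf_dvd_of_pow_eq_one h1) (orderOf_dvd_of_pow_eq_one hsk)
    rwa [(hpk.pow_left _).gcd_eq_one, Nat.dvd_one, orderOf_eq_one_iff] at h2
  have htriv : ∀ {p r : ℕ}, p.Prime → r.Prime → p ≠ r → ∀ i, (∀ z, (f i)^[r] z = z) →
      i ∈ S p (w p) → ∀ z, (α i z / z) ^ m p = 1 := by
    intro p r hp hr hpr i hir hi z
    have hcop := (Nat.coprime_primes hp hr).2 hpr
    set z' := (α i z / z) ^ m p with hz'
    have hz'div : α i (z ^ m p) / z ^ m p = z' := by rw [hz', map_pow, div_pow]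
    have hsub : S p (w p * z') ⊆ S p (w p) := by
      intro j hj
      have hj' : (f j (w p * z') / (w p * z')) ^ m p = 1 := hj
      have hi' : (f i (w p) / w p) ^ m p = 1 := hi
      rw [hmul, mul_pow] at hj'
      set t := f j (w p) / w p with ht
      set d := f i (w p) / w p with hd
      have hfix : α i (t ^ m p) = t ^ m p := by
        have e1 : f j (w p) = w p * t := by rw [ht, mul_div_cancel]
        have e2 : f i (w p) = w p * d := by rw [hd, mul_div_cancel]
        have h := hcomm i j (w p)
        rw [e1, e2, hf, hf, e1, e2, mul_assoc, mul_assoc] at h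
        have h' := congrArg (· ^ m p) (mul_left_cancel h)
        simp only [mul_pow, ← map_pow, hi', map_one, mul_one, one_mul] at h'
        exact h'
      have hfix' : α i (t ^ m p)⁻¹ = (t ^ m p)⁻¹ := by rw [map_inv, hfix]
      have hdiv : α i ((α j (z ^ m p) / z ^ m p) ^ m p) / (α j (z ^ m p) / z ^ m p) ^ m p
          = (t ^ m p)⁻¹ := by
        rw [← eq_inv_iff_mul_eq_one.2 ((mul_comm _ _).trans hj'), ← hz'div, map_pow, ← div_pow,
          map_div, map_div, hαcomm i j, div_div_div_comm]
      have := pow_eq_one_of_map_div (α i) (hαiter i r hir _) hdiv hfix'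
      have := hone hcop (inv_pow t (m p)).symm this
      exact inv_eq_one.1 this
    have hmem : i ∈ S p (w p * z') := hwmin p _ hsub hi
    have hmem' : (f i (w p * z') / (w p * z')) ^ m p = 1 := hmem
    have hi' : (f i (w p) / w p) ^ m p = 1 := hi
    rw [hmul, mul_pow, hi', one_mul] at hmem'
    have hfix : α i z' = z' := by
      refine div_eq_one.1 (hone (Nat.coprime_ordCompl hp hn0) (t := α i (α i z / z) / (α i z / z)) ?_ hmem')
      rw [hz', map_pow, ← div_pow]
    exact hone hcop hz' (pow_eq_one_of_map_div (α i) (hαiter i r hir _) hz'div hfix)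
  obtain ⟨u, hu⟩ := exists_pow_ordCompl_div_eq_one w
  refine ⟨u, fun i r hr hir hiu => ?_⟩
  have hmem : ∀ p : ℕ, p.Prime → i ∈ S p (w p) := by
    intro p hp
    have h := hmul i (w p) (u / w p)
    rw [mul_div_cancel, hiu, div_self'] at h
    have h' := congrArg (· ^ m p) h
    have hup : (u / w p) ^ m p = 1 := hu p hp
    simp only [one_pow, mul_pow, div_pow _ (u / w p), ← map_pow] at h'
    rw [hup, map_one, div_one, mul_one] at h'
    exact h'.symm
  have hall : ∀ p : ℕ, p.Prime → (f i (y r) / y r) ^ m p = 1 := by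
    intro p hp
    rcases eq_or_ne p r with rfl | hpr
    · exact hw p (hmem p hp)
    · have h := hmul i (w p) (y r / w p)
      rw [mul_div_cancel] at h
      rw [h, mul_pow, htriv hp hr hpr i hir (hmem p hp), mul_one]
      exact hmem p hp
  rw [← div_eq_one, ← orderOf_eq_one_iff]
  by_contra hne
  obtain ⟨p, hp, hpd⟩ := Nat.exists_prime_and_dvd hne
  exact Nat.not_dvd_ordCompl hp hn0 (hpd.trans (orderOf_dvd_of_pow_eq_one (hall p hp)))

/-- If a finite group acts faithfully by coordinatewise semilinear maps and has for every prime `r`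
an orbit with stabilizer of order prime to `r`, then it has a regular orbit. -/
theorem exists_stabilizer_eq_bot_of_coordinatewise_semilinear {N V Ω F L : Type*} [Group N]
    [Finite N] [MulAction N V] [FaithfulSMul N V] [Finite Ω] [Field F] [Field L] [Finite L]
    [Algebra F L] (Φ : (Ω → L) ≃ V)
    (hΦ : ∀ n : N, ∃ (b : Ω → Lˣ) (σ : Ω → (L ≃ₐ[F] L)), ∀ a : Ω → L,
      n • Φ a = Φ fun i => (b i : L) * σ i (a i))
    (hreg : ∀ r : ℕ, r.Prime → ∃ v : V, ¬ r ∣ Nat.card (MulAction.stabilizer N v)) :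
    ∃ v : V, MulAction.stabilizer N v = ⊥ := by
  classical
  choose b σ hΦ using hΦ
  let ψ : (Ω → Lˣ) → V := fun a => Φ fun i => (a i : L)
  have hψinj : Function.Injective ψ := by
    intro a c h
    ext i
    exact congrFun (Φ.injective h) i
  let α : N → (Ω → Lˣ) →* (Ω → Lˣ) := fun n =>
    { toFun := fun a i => Units.map (σ n i : L →* L) (a i)
      map_one' := by ext; simp
      map_mul' := by intros; ext; simp }
  have hψ : ∀ n a, n • ψ a = ψ (b n * α n a) := fun n a => hΦ n _
  have hσ_unique : ∀ {n : N} {c : Ω → Lˣ} {τ : Ω → (L ≃ₐ[F] L)},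
      (∀ a : Ω → L, (fun i => (b n i : L) * σ n i (a i)) = fun i => (c i : L) * τ i (a i)) →
      σ n = τ := by
    intro n c τ h
    ext i z
    have h1 := congrFun (h fun _ => 1) i
    have h2 := congrFun (h fun _ => z) i
    simp only [map_one, mul_one] at h1 h2
    rw [h1] at h2
    exact mul_left_cancel₀ (Units.ne_zero _) h2
  let s : N →* (Ω → (L ≃ₐ[F] L)) := MonoidHom.mk' σ fun n k =>
    hσ_unique (c := b n * α n (b k)) fun a => by
      rw [← Φ.apply_eq_iff_eq, ← hΦ, mul_smul, hΦ, hΦ]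
      congr 1
      ext i
      simp [α, mul_assoc]
  let M : Subgroup (Ω → Lˣ) :=
    { carrier := {m | ∃ n : N, ∀ a : Ω → L, n • Φ a = Φ fun i => (m i : L) * a i}
      one_mem' := ⟨1, fun a => by simp⟩
      mul_mem' := by
        rintro x y ⟨n, hn⟩ ⟨k, hk⟩
        refine ⟨n * k, fun a => ?_⟩
        rw [mul_smul, hk, hn]
        simp [mul_assoc]
      inv_mem' := by
        rintro x ⟨n, hn⟩
        refine ⟨n⁻¹, fun a => ?_⟩
        rw [inv_smul_eq_iff, hn]
        simp }
  have hαM : ∀ n, M ≤ M.comap (α n) := by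
    rintro n m ⟨k, hk⟩
    refine ⟨n * k * n⁻¹, fun a => ?_⟩
    obtain ⟨c, hc⟩ : ∃ c, Φ c = n⁻¹ • Φ a := ⟨_, Φ.apply_symm_apply _⟩
    have hc' : Φ a = n • Φ c := by rw [hc, smul_inv_smul]
    rw [mul_smul, mul_smul, ← hc, hk, hΦ]
    rw [hΦ, Φ.apply_eq_iff_eq] at hc'
    rw [hc']
    congr 1
    ext i
    simp [α, mul_left_comm]
  let f : N → (Ω → Lˣ) ⧸ M → (Ω → Lˣ) ⧸ M := fun n y =>
    (b n : (Ω → Lˣ) ⧸ M) * QuotientGroup.map M M (α n) (hαM n) y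
  have hfψ : ∀ n (a : Ω → Lˣ), f n a = ((b n * α n a : Ω → Lˣ) : (Ω → Lˣ) ⧸ M) :=
    fun n a => rfl
  have hfmul : ∀ n k y, f (n * k) y = f n (f k y) := by
    intro n k y
    obtain ⟨a, rfl⟩ := QuotientGroup.mk_surjective y
    rw [hfψ k, hfψ, hfψ]
    congr 1
    apply hψinj
    rw [← hψ, ← hψ, ← hψ, mul_smul]
  have hfone : ∀ y, f 1 y = y := by
    intro y
    obtain ⟨a, rfl⟩ := QuotientGroup.mk_surjective y
    rw [hfψ]
    congr 1
    apply hψinj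
    rw [← hψ, one_smul]
  have hcomm : ∀ n k y, f n (f k y) = f k (f n y) := by
    intro n k y
    obtain ⟨a, rfl⟩ := QuotientGroup.mk_surjective y
    rw [hfψ, hfψ, hfψ, hfψ, eq_comm, QuotientGroup.eq]
    refine ⟨n * k * (k * n)⁻¹, fun c => ?_⟩
    obtain ⟨d, hd⟩ : ∃ d, Φ d = (k * n)⁻¹ • Φ c := ⟨_, Φ.apply_symm_apply _⟩
    have hd' : Φ c = (k * n) • Φ d := by rw [hd, smul_inv_smul]
    rw [mul_smul, ← hd, mul_smul, hΦ, hΦ]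
    rw [mul_smul, hΦ, hΦ, Φ.apply_eq_iff_eq] at hd'
    rw [hd']
    congr 1
    ext i
    have hσ : ∀ z, σ n i (σ k i z) = σ k i (σ n i z) := fun z =>
      DFunLike.congr_fun (IsMulCommutative.is_comm.comm (σ n i) (σ k i)) z
    have h1 : ∀ (τ : L ≃ₐ[F] L) (u : Lˣ), τ (u : L) ≠ 0 := fun τ u => by simp
    have h2 := h1 (σ k i) (b n i)
    have h3 := h1 (σ k i * σ n i) (a i)
    simp only [AlgEquiv.mul_apply] at h3
    simp [α, hσ]
    field_simp
  have hpoint : ∀ r : ℕ, ∃ a : Ω → Lˣ, r.Prime →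
      ¬ r ∣ Nat.card (MulAction.stabilizer N (ψ a)) := by
    intro r
    by_cases hr : r.Prime
    swap
    · exact ⟨1, fun h => absurd h hr⟩
    obtain ⟨v, hv⟩ := hreg r hr
    obtain ⟨c, rfl⟩ := Φ.surjective v
    refine ⟨fun i => if h : c i = 0 then 1 else Units.mk0 (c i) h, fun _ hdvd => hv ?_⟩
    refine hdvd.trans (Subgroup.card_dvd_of_le fun n hn => ?_)
    rw [MulAction.mem_stabilizer_iff] at hn ⊢
    rw [hΦ, Φ.apply_eq_iff_eq] at hn ⊢
    ext i
    have := congrFun hn i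
    by_cases h : c i = 0
    · simp [h]
    · simpa [h] using this
  choose y hy using hpoint
  obtain ⟨u, hu⟩ := exists_fixed_imp_fixed_of_affine f
    (fun n => QuotientGroup.map M M (α n) (hαM n))
    (fun n y z => by simp only [f, map_mul, mul_assoc]) hcomm (fun r => (y r : (Ω → Lˣ) ⧸ M))
  obtain ⟨a, rfl⟩ := QuotientGroup.mk_surjective u
  have hiter : ∀ (n : N) (k : ℕ) z, (f n)^[k] z = f (n ^ k) z := by
    intro n k z
    induction k with
    | zero => simp [hfone]
    | succ k ih => rw [Function.iterate_succ_apply', ih, pow_succ', hfmul]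
  have hfix : ∀ (n : N) (c : Ω → Lˣ), n • ψ c = ψ c → f n c = c := by
    intro n c h
    rw [hψ] at h
    rw [hfψ, hψinj h]
  refine ⟨ψ a, ?_⟩
  by_contra hne
  rw [← Subgroup.card_eq_one] at hne
  obtain ⟨r, hr, hrdvd⟩ := Nat.exists_prime_and_dvd hne
  have := Fact.mk hr
  obtain ⟨⟨x, hx⟩, hxord⟩ := exists_prime_orderOf_dvd_card' r hrdvd
  rw [Subgroup.orderOf_mk] at hxord
  rw [MulAction.mem_stabilizer_iff] at hx
  have hxr : ∀ z, (f x)^[r] z = z := by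
    intro z
    rw [hiter, ← hxord, pow_orderOf_eq_one, hfone]
  have hxy := hu x r hr hxr (hfix x a hx)
  rw [hfψ, eq_comm, QuotientGroup.eq] at hxy
  obtain ⟨k, hk⟩ := hxy
  have hkψ : k • ψ (y r) = x • ψ (y r) := by
    rw [hψ x]
    refine (hk _).trans ?_
    congr 1
    ext i
    simp [mul_comm]
  have hmem : k⁻¹ * x ∈ MulAction.stabilizer N (ψ (y r)) := by
    rw [MulAction.mem_stabilizer_iff, mul_smul, ← hkψ, inv_smul_smul]
  have hcop : (orderOf (k⁻¹ * x)).Coprime r := by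
    refine Nat.Coprime.coprime_dvd_left
      (Subgroup.orderOf_dvd_natCard (MulAction.stabilizer N (ψ (y r))) hmem) ?_
    exact ((Nat.Prime.coprime_iff_not_dvd hr).2 (hy r hr)).symm
  have hkσ : σ k = 1 :=
    hσ_unique (c := (y r)⁻¹ * (b x * α x (y r))) fun c => by
      rw [← Φ.apply_eq_iff_eq, ← hΦ]
      exact hk c
  have hxσ : σ x = 1 := by
    have h1 : s (k⁻¹ * x) = s x := by
      rw [map_mul, map_inv, show s k = 1 from hkσ, inv_one, one_mul]
    have h2 := Nat.dvd_gcd (h1 ▸ orderOf_map_dvd s (k⁻¹ * x)) (hxord ▸ orderOf_map_dvd s x)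
    rwa [hcop.gcd_eq_one, Nat.dvd_one, orderOf_eq_one_iff] at h2
  have hxb : b x = 1 := by
    rw [hΦ, Φ.apply_eq_iff_eq] at hx
    ext i
    simpa [hxσ] using congrFun hx i
  have hx1 : x = 1 := by
    refine FaithfulSMul.eq_of_smul_eq_smul (α := V) fun v => ?_
    obtain ⟨c, rfl⟩ := Φ.surjective v
    rw [hΦ, one_smul]
    simp [hxσ, hxb]
  rw [hx1, orderOf_one] at hxord
  exact hr.one_lt.ne hxord

/-- Let `q` be a prime power, `G` a finite group and `V` a finite,
faithful, irreducible `GF(q)G`-module.  Suppose `V` is induced from a submodule `W`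
such that for `H = N_G(W)` (the stabilizer of `W` in `G`) the group `H/C_G(W)` is
isomorphic, as a group of `GF(q)`-linear transformations of `W`, to an (irreducible)
subgroup of the semilinear group `Γ(W)` (where `W` is identified with the field
`GF(q^{dim W})`).  Let `N = ⋂_{g ∈ G} H^g ⊴ G` (the normal core of `H`) and assume `|N|`
is odd.  If `N` has an `r`-regular orbit on `V` for every prime `r`, then `N` has a
regular orbit on `V`.

Formalization notes: the field `GF(q)` is an arbitrary finite field `F`; `G` acts on `V`
by `F`-linear maps (`DistribMulAction G V` with `SMulCommClass G F V`) and on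
`Submodule F V` by the induced pointwise action, so that `H = N_G(W)` is
`MulAction.stabilizer G W`.  "`V` is induced from `W`" says that the distinct
`G`-translates of `W` (i.e. the orbit of `W`) are independent with sum `V`.  The
semilinearity hypothesis says: there is a finite field `L ⊇ F` and an `F`-linear
identification `e : W ≃ L` under which every `h ∈ H` acts on `W` as `x ↦ a·σ(x)` for
some `a ∈ Lˣ`, `σ ∈ Gal(L/F)`; such an element acts trivially on `W` iff it lies in
`C_G(W)`, so this precisely says `H/C_G(W)` embeds into `Γ(W)` as linear maps of `W`. -/
theorem stmt_1 {F V G : Type*} [Field F] [Fintype F] [AddCommGroup V] [Module F V]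
    [Fintype V] [Nontrivial V] [Group G] [Fintype G]
    [DistribMulAction G V] [SMulCommClass G F V] [FaithfulSMul G V]
    (hirr : ∀ W' : Submodule F V, (∀ (g : G), ∀ v ∈ W', g • v ∈ W') → W' = ⊥ ∨ W' = ⊤)
    (W : Submodule F V)
    -- V is induced from W:
    (hind : sSupIndep (MulAction.orbit G W : Set (Submodule F V)))
    (hspan : sSup (MulAction.orbit G W) = ⊤)
    -- H = N_G(W):
    (H : Subgroup G) (hH : H = MulAction.stabilizer G W)
    -- H/C_G(W) is (as linear transformations of W) a subgroup of Γ(W):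
    (L : Type*) [Field L] [Fintype L] [Algebra F L] (e : W ≃ₗ[F] L)
    (hsemi : ∀ h ∈ H, ∃ (a : Lˣ) (σ : L ≃ₐ[F] L),
      ∀ w : V, ∀ (hw : w ∈ W) (hw' : h • w ∈ W),
        e ⟨h • w, hw'⟩ = (a : L) * σ (e ⟨w, hw⟩))
    -- N = ⋂_{g ∈ G} H^g:
    (N : Subgroup G) (hN : N = H.normalCore)
    (hNodd : Odd (Nat.card N))
    -- N has an r-regular orbit on V for every prime r:
    (hreg : ∀ r : ℕ, r.Prime → ∃ v : V, ¬ r ∣ Nat.card (MulAction.stabilizer N v)) :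
    ∃ v : V, MulAction.stabilizer N v = ⊥ := by
  classical
  have : Finite (MulAction.orbit G W) := (Set.toFinite _)
  have := Fintype.ofFinite (MulAction.orbit G W)
  have hg : ∀ i : MulAction.orbit G W, ∃ g : G, g • W = i := fun i => i.2
  choose g hg using hg
  have hWmem : ∀ (i : MulAction.orbit G W) (x : L), g i • (e.symm x : V) ∈ (i : Submodule F V) := by
    intro i x
    have h := Submodule.smul_mem_pointwise_smul (e.symm x : V) (g i) W (e.symm x).2
    rwa [hg] at h
  let Φ : (MulAction.orbit G W → L) → V := fun a => ∑ i, g i • (e.symm (a i) : V)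
  have hinj : Function.Injective Φ := by
    intro a c hac
    have h := (iSupIndep_iff_finsetSum_eq_imp_eq _).1 ((sSupIndep_iff _).1 hind) Finset.univ
      (fun i => g i • (e.symm (a i) : V)) (fun i => g i • (e.symm (c i) : V))
      (fun i _ => ⟨hWmem i _, hWmem i _⟩) hac
    funext i
    have h' := smul_left_cancel _ (h i (Finset.mem_univ i))
    exact e.symm.injective (Subtype.ext h')
  have hsurj : Function.Surjective Φ := by
    intro v
    have hv : v ∈ ⨆ i ∈ (Finset.univ : Finset (MulAction.orbit G W)), (i : Submodule F V) := by
      simp only [Finset.mem_univ, iSup_pos]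
      rw [← sSup_eq_iSup', hspan]
      trivial
    obtain ⟨μ, rfl⟩ := (Submodule.mem_iSup_finset_iff_exists_sum _ _).1 hv
    have hμ : ∀ i, ∃ w ∈ W, g i • w = (μ i : V) := by
      intro i
      have h : (μ i : V) ∈ g i • W := (hg i).symm ▸ (μ i).2
      exact (Submodule.mem_smul_pointwise_iff_exists _ _ _).1 h
    choose w hw hwμ using hμ
    refine ⟨fun i => e ⟨w i, hw i⟩, Finset.sum_congr rfl fun i _ => ?_⟩
    rw [e.symm_apply_apply, hwμ]
  refine exists_stabilizer_eq_bot_of_coordinatewise_semilinear (F := F) (L := L)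
    (Equiv.ofBijective Φ ⟨hinj, hsurj⟩) (fun n => ?_) hreg
  have hnH : ∀ i, (g i)⁻¹ * n * g i ∈ H := by
    intro i
    have h : (n : G) ∈ H.normalCore := hN ▸ n.2
    simpa using h (g i)⁻¹
  have hmem : ∀ i, ∀ w ∈ W, ((g i)⁻¹ * n * g i) • w ∈ W := by
    intro i w hw
    have h := Submodule.smul_mem_pointwise_smul w ((g i)⁻¹ * n * g i) W hw
    have h' := hnH i
    rw [hH, MulAction.mem_stabilizer_iff] at h'
    rwa [h'] at h
  choose b σ hbσ using fun i => hsemi _ (hnH i)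
  refine ⟨b, σ, fun a => ?_⟩
  change n • ∑ i, g i • (e.symm (a i) : V) = ∑ i, g i • (e.symm ((b i : L) * σ i (a i)) : V)
  rw [Finset.smul_sum]
  refine Finset.sum_congr rfl fun i _ => ?_
  have h := hbσ i (e.symm (a i)) (e.symm (a i)).2 (hmem i _ (e.symm (a i)).2)
  rw [Subtype.coe_eta, e.apply_symm_apply] at h
  rw [← h, e.symm_apply_apply, ← mul_smul]
  simp only [mul_assoc, mul_inv_cancel_left]
  rw [mul_smul]
  rfl
end

section
/- Let q be a prime power, n a positive integer, s a prime dividing n, and let r be any prime dividing (q^n − 1)/(q^{n/s} − 1). Then r ≥ s, and either r = s or r ≡ 1 (mod s). -/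
theorem eq_or_mod_eq_one_of_dvd_geom_sum {x s r : ℕ} (hs : s.Prime) (hr : r.Prime)
    (h : r ∣ ∑ i ∈ Finset.range s, x ^ i) : r = s ∨ r % s = 1 := by
  have := Fact.mk hs
  have := Fact.mk hr
  have hsum : ∑ i ∈ Finset.range s, (x : ZMod r) ^ i = 0 := by
    exact_mod_cast (ZMod.natCast_eq_zero_iff _ r).2 h
  have hpow : (x : ZMod r) ^ s = 1 := by
    have hmul := geom_sum_mul (x : ZMod r) s
    rw [hsum, zero_mul] at hmul
    exact sub_eq_zero.1 hmul.symm
  by_cases hx : (x : ZMod r) = 1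
  · left
    simp only [hx, one_pow, Finset.sum_const, Finset.card_range, nsmul_eq_mul, mul_one] at hsum
    exact (Nat.prime_dvd_prime_iff_eq hr hs).1 ((ZMod.natCast_eq_zero_iff _ r).1 hsum)
  · right
    have hx0 : (x : ZMod r) ≠ 0 := by
      intro h0
      simp [h0, hs.ne_zero] at hpow
    have hdvd : s ∣ r - 1 := by
      rw [← orderOf_eq_prime hpow hx]
      exact orderOf_dvd_of_pow_eq_one (ZMod.pow_card_sub_one_eq_one hx0)
    have hmod : 1 ≡ r [MOD s] := (Nat.modEq_iff_dvd' hr.one_le).2 hdvd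
    rw [← hmod, Nat.mod_eq_of_lt hs.one_lt]

/-- Let `q` be a prime power, `n` a positive integer, `s` a prime dividing
`n`, and `r` any prime dividing `(q^n - 1)/(q^{n/s} - 1)`. Then `r ≥ s`, and either `r = s`
or `r ≡ 1 (mod s)`. -/
theorem stmt_4 (p k q n s r : ℕ) (hp : p.Prime) (hk : 0 < k) (hq : q = p ^ k)
    (hn : 0 < n) (hs : s.Prime) (hsn : s ∣ n) (hr : r.Prime)
    (hdvd : r ∣ (q ^ n - 1) / (q ^ (n / s) - 1)) :
    s ≤ r ∧ (r = s ∨ r % s = 1) := by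
  have hq1 : 1 < q := hq ▸ Nat.one_lt_pow hk.ne' hp.one_lt
  have hm : n / s ≠ 0 := (Nat.div_pos (Nat.le_of_dvd hn hsn) hs.pos).ne'
  have hx : 2 ≤ q ^ (n / s) := Nat.one_lt_pow hm hq1
  have hxs : q ^ n = (q ^ (n / s)) ^ s := by rw [← pow_mul, Nat.div_mul_cancel hsn]
  rw [hxs, ← Nat.geomSum_eq hx] at hdvd
  have key := eq_or_mod_eq_one_of_dvd_geom_sum hs hr hdvd
  refine ⟨?_, key⟩
  rcases key with rfl | hmod
  · exact le_rfl
  · by_contra! hlt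
    rw [Nat.mod_eq_of_lt hlt] at hmod
    exact hr.ne_one hmod
end

section
/- Let s be a prime dividing n, let σ ∈ Gal(q^n) be of order s, and set N = {x ∈ F(q^n) : N_σ(x) = 1}. Let r ≠ s be a prime dividing |N| and let b ∈ N have order r. Then the subgroup ⟨σ⟩⟨b⟩ of G(q^n) is a Frobenius group of order sr with Frobenius kernel ⟨b⟩; in particular, σ acts fixed-point-freely on ⟨b⟩ by conjugation: if 0 < i < s and σ^i(b^j) = b^j, then b^j = 1. -/
open SemidirectProduct

/-- The natural action of the Galois group `Gal(q^n) = (K ≃ₐ[F] K)` on the multiplicative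
group `F(q^n) = Kˣ`, defining the semidirect product
`G(q^n) = Gal(q^n) ⋉ F(q^n) = Kˣ ⋊[galAct F K] (K ≃ₐ[F] K)`. -/
def galAct (F K : Type*) [Field F] [Field K] [Algebra F K] :
    (K ≃ₐ[F] K) →* MulAut Kˣ where
  toFun σ := Units.mapEquiv σ.toRingEquiv.toMulEquiv
  map_one' := by ext x; rfl
  map_mul' σ τ := by ext x; rfl

section FrobeniusSubgroup

variable {F K : Type*} [Field F] [Field K] [Algebra F K]

/-- In a group, a nontrivial power of an element of prime order generates the same subgroup. -/
theorem mem_zpowers_of_mem_zpowers_of_prime_orderOf {G : Type*} [Group G] {g h : G}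
    (hg : (orderOf g).Prime) (hh : h ∈ Subgroup.zpowers g) (h1 : h ≠ 1) :
    g ∈ Subgroup.zpowers h := by
  have hle : Subgroup.zpowers h ≤ Subgroup.zpowers g := by simpa using hh
  have hord : orderOf h = orderOf g :=
    ((Nat.dvd_prime hg).1 (orderOf_dvd_of_mem_zpowers hh)).resolve_left (by simpa using h1)
  have : Finite (Subgroup.zpowers g) :=
    Nat.finite_of_card_ne_zero (by rw [Nat.card_zpowers]; exact hg.ne_zero)
  rw [Subgroup.eq_of_le_of_card_ge hle (by simp [Nat.card_zpowers, hord])]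
  exact Subgroup.mem_zpowers g

/-- A unit fixed by `σ` whose norm over `⟨σ⟩` is trivial and whose order divides a number coprime
to the order of `σ` is trivial. -/
theorem eq_one_of_norm_eq_one_of_fixed {σ : K ≃ₐ[F] K} {s r : ℕ} (hrs : s.Coprime r) {c : Kˣ}
    (hN : ∏ i ∈ Finset.range s, (σ ^ i) (c : K) = 1) (hc : c ^ r = 1) (hfix : σ (c : K) = c) :
    c = 1 := by
  have hpow (i : ℕ) : (σ ^ i) (c : K) = c := by
    induction i with
    | zero => simp
    | succ i ih => rw [pow_succ, AlgEquiv.mul_apply, hfix, ih]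
  have hcs : c ^ s = 1 := by
    ext
    simpa [hpow] using hN
  have := Nat.dvd_gcd (orderOf_dvd_of_pow_eq_one hcs) (orderOf_dvd_of_pow_eq_one hc)
  rwa [hrs.gcd_eq_one, Nat.dvd_one, orderOf_eq_one_iff] at this

theorem norm_zpow_eq_one {σ : K ≃ₐ[F] K} {s : ℕ} {b : Kˣ}
    (hb : ∏ i ∈ Finset.range s, (σ ^ i) (b : K) = 1) (j : ℤ) :
    ∏ i ∈ Finset.range s, (σ ^ i) ((b ^ j : Kˣ) : K) = 1 := by
  simp only [Units.val_zpow_eq_zpow_val, map_zpow₀, Finset.prod_zpow, hb, one_zpow]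

/-- Nontrivial powers of `σ` act fixed-point-freely on `⟨b⟩`. -/
theorem eq_one_of_fixed_of_mem_zpowers {σ ρ : K ≃ₐ[F] K} {b c : Kˣ} (hσ : (orderOf σ).Prime)
    (hco : (orderOf σ).Coprime (orderOf b))
    (hb : ∏ i ∈ Finset.range (orderOf σ), (σ ^ i) (b : K) = 1)
    (hρ : ρ ∈ Subgroup.zpowers σ) (hρ1 : ρ ≠ 1) (hc : c ∈ Subgroup.zpowers b)
    (hfix : ρ (c : K) = c) : c = 1 := by
  obtain ⟨j, rfl⟩ := Subgroup.mem_zpowers_iff.1 hc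
  have hle : Subgroup.zpowers ρ ≤ MulAction.stabilizer (K ≃ₐ[F] K) ((b ^ j : Kˣ) : K) := by
    rw [Subgroup.zpowers_le]
    exact hfix
  refine eq_one_of_norm_eq_one_of_fixed hco (norm_zpow_eq_one hb j) ?_
    (hle (mem_zpowers_of_mem_zpowers_of_prime_orderOf hσ hρ hρ1))
  exact orderOf_dvd_iff_pow_eq_one.1 (orderOf_dvd_of_mem_zpowers hc)

/-- Every subgroup of the cyclic group `Kˣ` is stable under the Galois group. -/
theorem galAct_mem [Finite K] (H : Subgroup Kˣ) (ρ : K ≃ₐ[F] K) {c : Kˣ} (hc : c ∈ H) :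
    galAct F K ρ c ∈ H := by
  obtain ⟨m, hm⟩ := MonoidHom.map_cyclic (galAct F K ρ).toMonoidHom
  have : galAct F K ρ c = c ^ m := hm c
  rw [this]
  exact H.zpow_mem hc m

/-- The subgroup of `Kˣ ⋊ Gal(K/F)` of pairs with components in given subgroups. -/
def galProd [Finite K] (H : Subgroup Kˣ) (P : Subgroup (K ≃ₐ[F] K)) :
    Subgroup (Kˣ ⋊[galAct F K] (K ≃ₐ[F] K)) where
  carrier := {g | g.left ∈ H ∧ g.right ∈ P}
  one_mem' := ⟨H.one_mem, P.one_mem⟩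
  mul_mem' := fun hx hy =>
    ⟨H.mul_mem hx.1 (galAct_mem H _ hy.1), P.mul_mem hx.2 hy.2⟩
  inv_mem' := fun hx => ⟨galAct_mem H _ (H.inv_mem hx.1), P.inv_mem hx.2⟩

theorem mem_galProd [Finite K] {H : Subgroup Kˣ} {P : Subgroup (K ≃ₐ[F] K)}
    {g : Kˣ ⋊[galAct F K] (K ≃ₐ[F] K)} : g ∈ galProd H P ↔ g.left ∈ H ∧ g.right ∈ P :=
  Iff.rfl

theorem card_galProd [Finite K] (H : Subgroup Kˣ) (P : Subgroup (K ≃ₐ[F] K)) :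
    Nat.card (galProd H P) = Nat.card P * Nat.card H := by
  rw [mul_comm, ← Nat.card_prod]
  exact Nat.card_congr
    { toFun := fun g => (⟨g.1.left, g.2.1⟩, ⟨g.1.right, g.2.2⟩)
      invFun := fun p => ⟨⟨p.1, p.2⟩, p.1.2, p.2.2⟩
      left_inv := fun _ => rfl
      right_inv := fun _ => rfl }

theorem closure_inr_inl_eq_galProd [Finite K] (σ : K ≃ₐ[F] K) (b : Kˣ) :
    Subgroup.closure {(inr σ : Kˣ ⋊[galAct F K] (K ≃ₐ[F] K)), inl b} =
      galProd (Subgroup.zpowers b) (Subgroup.zpowers σ) := by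
  apply le_antisymm
  · rw [Subgroup.closure_le]
    rintro g (rfl | rfl)
    · exact ⟨Subgroup.one_mem _, Subgroup.mem_zpowers σ⟩
    · exact ⟨Subgroup.mem_zpowers b, Subgroup.one_mem _⟩
  · rintro g ⟨h1, h2⟩
    obtain ⟨i, hi⟩ := Subgroup.mem_zpowers_iff.1 h1
    obtain ⟨j, hj⟩ := Subgroup.mem_zpowers_iff.1 h2
    rw [← inl_left_mul_inr_right g, ← hi, ← hj, map_zpow, map_zpow]
    exact Subgroup.mul_mem _
      (Subgroup.zpow_mem _ (Subgroup.subset_closure (by simp)) i)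
      (Subgroup.zpow_mem _ (Subgroup.subset_closure (by simp)) j)

theorem mem_map_inl_iff {H : Subgroup Kˣ} {g : Kˣ ⋊[galAct F K] (K ≃ₐ[F] K)} :
    g ∈ H.map (inl : Kˣ →* Kˣ ⋊[galAct F K] (K ≃ₐ[F] K)) ↔ g.left ∈ H ∧ g.right = 1 := by
  constructor
  · rintro ⟨c, hc, rfl⟩
    exact ⟨hc, rfl⟩
  · rintro ⟨h1, h2⟩
    exact ⟨g.left, h1, SemidirectProduct.ext rfl h2.symm⟩

theorem map_inl_normal [Finite K] (H : Subgroup Kˣ) :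
    (H.map (inl : Kˣ →* Kˣ ⋊[galAct F K] (K ≃ₐ[F] K))).Normal := by
  refine ⟨?_⟩
  rintro _ ⟨c, hc, rfl⟩ g
  refine ⟨galAct F K g.right c, galAct_mem H _ hc, ?_⟩
  apply SemidirectProduct.ext <;> simp [mul_comm]

end FrobeniusSubgroup

/-- Let `s` be a prime dividing `n`, `σ ∈ Gal(q^n)` of order `s`, and
`N = {x ∈ F(q^n) : N_σ(x) = 1}`.  Let `r ≠ s` be a prime dividing `|N|` and `b ∈ N` of
order `r`.  Then the subgroup `⟨σ⟩⟨b⟩` of `G(q^n)` is a Frobenius group of order `s·r`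
with Frobenius kernel `⟨b⟩`; in particular `σ` acts fixed-point-freely on `⟨b⟩`:
if `0 < i < s` and `σ^i(b^j) = b^j` then `b^j = 1`.

"`T` is a Frobenius group with Frobenius kernel `L`" is rendered internally: `L` is a
nontrivial proper normal subgroup of `T` and every element of `T` outside `L` centralizes
no nontrivial element of `L`. -/
theorem stmt_5 (F K : Type*) [Field F] [Field K] [Fintype F] [Fintype K] [Algebra F K]
    (q n s r : ℕ) (hq : Fintype.card F = q) (hK : Fintype.card K = q ^ n)
    (hs : s.Prime) (hsn : s ∣ n) (σ : K ≃ₐ[F] K) (hσ : orderOf σ = s)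
    (hr : r.Prime) (hrs : r ≠ s)
    (hrN : r ∣ Nat.card {x : Kˣ | ∏ i ∈ Finset.range s, (σ ^ i) (x : K) = 1})
    (b : Kˣ) (hb : ∏ i ∈ Finset.range s, (σ ^ i) (b : K) = 1) (hbord : orderOf b = r) :
    ∀ T L : Subgroup (Kˣ ⋊[galAct F K] (K ≃ₐ[F] K)),
      T = Subgroup.closure {inr σ, inl b} →
      L = (Subgroup.zpowers b).map (inl : Kˣ →* Kˣ ⋊[galAct F K] (K ≃ₐ[F] K)) →
      (Nat.card T = s * r ∧ L ≤ T ∧ L ≠ ⊥ ∧ L ≠ T ∧ (L.subgroupOf T).Normal ∧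
        ∀ t ∈ T, t ∉ L → ∀ x ∈ L, t * x = x * t → x = 1) ∧
      ∀ (i : ℕ) (j : ℤ), 0 < i → i < s →
        (σ ^ i) ((b ^ j : Kˣ) : K) = ((b ^ j : Kˣ) : K) → b ^ j = 1 := by
  subst hσ hbord
  have hco : (orderOf σ).Coprime (orderOf b) := (Nat.coprime_primes hs hr).2 hrs.symm
  have hσ1 : σ ≠ 1 := fun h => hs.one_lt.ne' (by simp [h])
  have hb1 : b ≠ 1 := fun h => hr.one_lt.ne' (by simp [h])
  rintro T L rfl rfl
  rw [closure_inr_inl_eq_galProd]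
  refine ⟨⟨?_, ?_, ?_, ?_, ?_, ?_⟩, ?_⟩
  · rw [card_galProd, Nat.card_zpowers, Nat.card_zpowers]
  · intro g hg
    rw [mem_map_inl_iff] at hg
    exact ⟨hg.1, hg.2 ▸ Subgroup.one_mem _⟩
  · rw [Ne, Subgroup.map_eq_bot_iff_of_injective _ inl_injective, Subgroup.zpowers_eq_bot]
    exact hb1
  · intro h
    have hmem : (inr σ : Kˣ ⋊[galAct F K] (K ≃ₐ[F] K)) ∈
        galProd (Subgroup.zpowers b) (Subgroup.zpowers σ) :=
      ⟨Subgroup.one_mem _, Subgroup.mem_zpowers σ⟩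
    rw [← h, mem_map_inl_iff] at hmem
    exact hσ1 hmem.2
  · exact (map_inl_normal _).subgroupOf _
  · rintro t ht htL _ ⟨c, hc, rfl⟩ hcomm
    have hright : t.right ≠ 1 := fun h => htL (mem_map_inl_iff.2 ⟨ht.1, h⟩)
    have hfix : galAct F K t.right c = c := by
      have := congrArg SemidirectProduct.left hcomm
      simpa [mul_comm c] using this
    rw [eq_one_of_fixed_of_mem_zpowers hs hco hb ht.2 hright hc (congrArg Units.val hfix), map_one]
  · intro i j hi his hfix
    exact eq_one_of_fixed_of_mem_zpowers hs hco hb (Subgroup.npow_mem_zpowers σ i)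
      (pow_ne_one_of_lt_orderOf hi.ne' his) (Subgroup.zpow_mem_zpowers b j) hfix
end

section
/- Let A be a subgroup of G(q^n) and set B = A ∩ F(q^n). Then there exists a conjugate A₁ of A in G(q^n) such that for every x ∈ A \ B of prime order q_x, there is σ ∈ A₁ ∩ Gal(q^n) with σ ≠ 1 and σ^{q_x} = 1. -/
open SemidirectProduct

/-- The product `u * f u * ⋯ * f^(k-1) u` of the first `k` iterates of an automorphism `f`. -/
def partialNorm {N : Type*} [CommGroup N] (f : MulAut N) (k : ℕ) : N →* N where
  toFun u := ∏ i ∈ Finset.range k, (f ^ i) u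
  map_one' := by simp
  map_mul' u v := by simp [Finset.prod_mul_distrib]

section PartialNorm

variable {N : Type*} [CommGroup N]

lemma partialNorm_apply (f : MulAut N) (k : ℕ) (u : N) :
    partialNorm f k u = ∏ i ∈ Finset.range k, (f ^ i) u := rfl

lemma partialNorm_zero (f : MulAut N) (u : N) : partialNorm f 0 u = 1 := by
  simp [partialNorm_apply]

lemma partialNorm_succ (f : MulAut N) (k : ℕ) (u : N) :
    partialNorm f (k + 1) u = partialNorm f k u * (f ^ k) u := by
  simp [partialNorm_apply, Finset.prod_range_succ]

lemma mul_map_partialNorm (f : MulAut N) (k : ℕ) (u : N) :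
    u * f (partialNorm f k u) = partialNorm f (k + 1) u := by
  simp [partialNorm_apply, Finset.prod_range_succ', pow_succ', mul_comm]

lemma partialNorm_of_fixed {f : MulAut N} {u : N} (h : f u = u) (k : ℕ) :
    partialNorm f k u = u ^ k := by
  have hi (i : ℕ) : (f ^ i) u = u := by
    induction i with
    | zero => simp
    | succ i ih => rw [pow_succ, MulAut.mul_apply, h, ih]
  simp [partialNorm_apply, hi]

lemma map_partialNorm_of_pow_eq_one {f : MulAut N} {m : ℕ} (hf : f ^ m = 1) (u : N) :
    f (partialNorm f m u) = partialNorm f m u := by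
  have h := mul_map_partialNorm f m u
  rw [partialNorm_succ, hf, MulAut.one_apply, mul_comm] at h
  exact mul_right_cancel h

lemma partialNorm_comm (f : MulAut N) (r s k : ℕ) (u : N) :
    partialNorm (f ^ r) k (partialNorm f s u) = partialNorm f s (partialNorm (f ^ r) k u) := by
  simp only [partialNorm_apply, map_prod]
  rw [Finset.prod_comm]
  refine Finset.prod_congr rfl fun i _ => Finset.prod_congr rfl fun j _ => ?_
  rw [← MulAut.mul_apply, ← MulAut.mul_apply, ← pow_mul, ← pow_add, ← pow_add, add_comm]

variable {G : Type*} [Group G] {φ : G →* MulAut N}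

lemma SemidirectProduct.pow_right (x : N ⋊[φ] G) (k : ℕ) : (x ^ k).right = x.right ^ k :=
  map_pow rightHom x k

lemma SemidirectProduct.pow_left (x : N ⋊[φ] G) (k : ℕ) :
    (x ^ k).left = partialNorm (φ x.right) k x.left := by
  induction k with
  | zero => simp [partialNorm_zero]
  | succ k ih =>
    rw [pow_succ, mul_left, ih, SemidirectProduct.pow_right, map_pow, partialNorm_succ]

lemma partialNorm_mul (z : N ⋊[φ] G) (r k : ℕ) :
    partialNorm (φ z.right ^ r) k (partialNorm (φ z.right) r z.left) =
      partialNorm (φ z.right) (r * k) z.left := by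
  rw [← SemidirectProduct.pow_left, ← SemidirectProduct.pow_left, pow_mul,
    SemidirectProduct.pow_left (z ^ r), SemidirectProduct.pow_right, map_pow]

/-- An element `x` of order dividing `k` in the same coset as `z ^ r` shows that the `r`-th power
of `z ^ (r * k)` is a norm. -/
lemma pow_partialNorm_mem_map {A : Subgroup (N ⋊[φ] G)} {z x : N ⋊[φ] G} (hz : z ∈ A) (hx : x ∈ A)
    {r k : ℕ} (hxr : x.right = z.right ^ r) (hxk : x ^ k = 1) (hm : z.right ^ (r * k) = 1) :
    partialNorm (φ z.right) (r * k) z.left ^ r ∈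
      (A.comap inl).map (partialNorm (φ z.right) (r * k)) := by
  have hzr : z ^ r * x⁻¹ ∈ A := A.mul_mem (A.pow_mem hz r) (A.inv_mem hx)
  have hb : z ^ r * x⁻¹ = inl (partialNorm (φ z.right) r z.left * x.left⁻¹) := by
    rw [mul_inv_eq_iff_eq_mul]
    ext
    · simp [SemidirectProduct.pow_left]
    · simp [SemidirectProduct.pow_right, hxr]
  rw [hb] at hzr
  refine ⟨_, hzr, ?_⟩
  have hx1 : partialNorm (φ z.right ^ r) k x.left = 1 := by
    rw [← map_pow, ← hxr, ← SemidirectProduct.pow_left, hxk, one_left]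
  have h (u : N) : partialNorm (φ z.right) (r * k) u =
      partialNorm (φ z.right) r (partialNorm (φ z.right ^ r) k u) := by
    rw [← partialNorm_comm]
    exact (partialNorm_mul (⟨u, z.right⟩ : N ⋊[φ] G) r k).symm
  rw [h (_ * _), map_mul, map_inv, hx1, inv_one, mul_one, partialNorm_mul,
    partialNorm_of_fixed]
  exact map_partialNorm_of_pow_eq_one (by rw [← map_pow, hm, map_one]) _

lemma Subgroup.mem_of_pow_div_prime_mem {H : Subgroup N} {m : ℕ} (hm : Squarefree m) {t : N}
    (htm : t ^ m ∈ H) (ht : ∀ p : ℕ, p.Prime → p ∣ m → t ^ (m / p) ∈ H) : t ∈ H := by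
  have key (k : ℕ) : t ^ k ∈ H ↔ orderOf (t : N ⧸ H) ∣ k := by
    rw [orderOf_dvd_iff_pow_eq_one, ← QuotientGroup.mk_pow, QuotientGroup.eq_one_iff]
  have h1 : orderOf (t : N ⧸ H) = 1 := by
    by_contra h
    obtain ⟨p, hp, hpd⟩ := Nat.exists_prime_and_dvd h
    have hpm := hpd.trans ((key m).1 htm)
    have hpp := hpd.trans ((key _).1 (ht p hp hpm))
    exact hp.one_lt.ne' (Nat.isUnit_iff.1 (hm p
      ((mul_dvd_mul_left p hpp).trans (Nat.mul_div_cancel' hpm).dvd)))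
  simpa [h1] using (key 1)

/-- A coset of squarefree order `m` contains an element of order dividing `m` as soon as, for
every prime `p` dividing `m`, its `m / p`-th power contains an element of order dividing `p`. -/
lemma exists_pow_eq_one_of_forall_prime {A : Subgroup (N ⋊[φ] G)} {σ : G} {m : ℕ}
    (hm : Squarefree m) (hσ : σ ∈ A.map rightHom) (hσm : σ ^ m = 1)
    (h : ∀ p : ℕ, p.Prime → p ∣ m → ∃ x ∈ A, x.right = σ ^ (m / p) ∧ x ^ p = 1) :
    ∃ y ∈ A, y.right = σ ∧ y ^ m = 1 := by
  obtain ⟨z, hz, rfl⟩ := hσ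
  rw [rightHom_eq_right] at *
  have ht : partialNorm (φ z.right) m z.left ∈
      (A.comap inl).map (partialNorm (φ z.right) m) := by
    refine Subgroup.mem_of_pow_div_prime_mem hm ?_ fun p hp hpm => ?_
    · have := pow_partialNorm_mem_map (r := m) (k := 1) hz A.one_mem
        (by simp [hσm]) (one_pow 1) (by simpa using hσm)
      simpa using this
    · obtain ⟨x, hx, hxr, hxp⟩ := h p hp hpm
      have := pow_partialNorm_mem_map hz hx hxr hxp (by rwa [Nat.div_mul_cancel hpm])
      rwa [Nat.div_mul_cancel hpm] at this
  obtain ⟨b, hb, hbt⟩ := ht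
  refine ⟨inl b⁻¹ * z, A.mul_mem (by simpa using hb) hz, by simp, ?_⟩
  ext
  · simp [SemidirectProduct.pow_left, hbt]
  · simp [SemidirectProduct.pow_right, hσm]

end PartialNorm

section Galois

variable {F K : Type*} [Field F] [Field K] [Algebra F K]

lemma galAct_apply_coe (σ : K ≃ₐ[F] K) (u : Kˣ) : (galAct F K σ u : K) = σ u := rfl

/-- Hilbert's Theorem 90 for the cyclic group generated by an automorphism `σ`. -/
lemma exists_mul_galAct_eq_of_partialNorm_eq_one {σ : K ≃ₐ[F] K} (hσ : 0 < orderOf σ) {c : Kˣ}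
    (hc : partialNorm (galAct F K σ) (orderOf σ) c = 1) :
    ∃ e : Kˣ, c * galAct F K σ e = e := by
  set m := orderOf σ with hm
  let w (i : ℕ) : Kˣ := partialNorm (galAct F K σ) i c
  let ψ (i : Fin m) : K →* K := ((σ ^ (i : ℕ) : K ≃ₐ[F] K) : K →* K)
  have hψ : Function.Injective ψ := by
    intro i j hij
    have : σ ^ (i : ℕ) = σ ^ (j : ℕ) := AlgEquiv.ext fun u => DFunLike.congr_fun hij u
    exact Fin.ext (pow_injOn_Iio_orderOf i.2 j.2 this)
  have hli : LinearIndependent K fun i => (ψ i : K → K) :=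
    (linearIndependent_monoidHom K K).comp ψ hψ
  obtain ⟨u, hu⟩ : ∃ u : K, ∑ i ∈ Finset.range m, (w i : K) * (σ ^ i) u ≠ 0 := by
    by_contra! h
    refine (w 0).ne_zero (Fintype.linearIndependent_iff.1 hli (fun i => (w i : K)) ?_ ⟨0, hσ⟩)
    ext u
    have := h u
    rw [Finset.sum_range] at this
    simpa [ψ] using this
  refine ⟨Units.mk0 _ hu, Units.ext ?_⟩
  have hstep (i : ℕ) : (c : K) * σ (w i * (σ ^ i) u) = w (i + 1) * (σ ^ (i + 1)) u := by
    have := congrArg Units.val (mul_map_partialNorm (galAct F K σ) i c)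
    rw [Units.val_mul, galAct_apply_coe] at this
    rw [map_mul, ← mul_assoc, this, pow_succ', AlgEquiv.mul_apply]
  rw [Units.val_mul, galAct_apply_coe, Units.val_mk0, map_sum, Finset.mul_sum]
  simp only [hstep]
  have h1 := Finset.sum_range_succ (fun i => (w i : K) * (σ ^ i) u) m
  rw [Finset.sum_range_succ'] at h1
  have h2 : (w m : K) * (σ ^ m) u = w 0 * (σ ^ 0) u := by
    rw [show w m = 1 from hc, show w 0 = 1 from partialNorm_zero _ _, hm, pow_orderOf_eq_one,
      pow_zero]
  rw [h2] at h1
  exact add_right_cancel h1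

/-- An element of `Gal ⋉ Kˣ` of the same order as its Galois component is conjugate to it. -/
lemma exists_conj_eq_inr {y : Kˣ ⋊[galAct F K] (K ≃ₐ[F] K)} (h0 : 0 < orderOf y.right)
    (hy : y ^ orderOf y.right = 1) :
    ∃ g, MulAut.conj g y = inr y.right := by
  have hc : partialNorm (galAct F K y.right) (orderOf y.right) y.left = 1 := by
    rw [← SemidirectProduct.pow_left, hy, one_left]
  obtain ⟨e, he⟩ := exists_mul_galAct_eq_of_partialNorm_eq_one h0 hc
  refine ⟨inl e⁻¹, ?_⟩
  rw [MulAut.conj_apply, mul_inv_eq_iff_eq_mul]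
  ext1
  · simp only [mul_left, left_inl, right_inl, map_one, MulAut.one_apply, left_inr, right_inr,
      one_mul, map_inv (galAct F K y.right)]
    rw [inv_mul_eq_iff_eq_mul, eq_mul_inv_iff_mul_eq, he]
  · simp

end Galois

/-- In a commutative group, elements `ρ p` of order `p` for finitely many primes `p` multiply to
an element whose suitable powers recover powers of the `ρ p`. -/
lemma prod_pow_prod_div {G : Type*} [CommGroup G] {P : Finset ℕ} (hP : ∀ p ∈ P, p.Prime)
    {ρ : ℕ → G} (hρ : ∀ p ∈ P, ρ p ^ p = 1) {p : ℕ} (hp : p ∈ P) :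
    (∏ l ∈ P, ρ l) ^ ((∏ l ∈ P, l) / p) = ρ p ^ ((∏ l ∈ P, l) / p) := by
  rw [← Finset.prod_pow, Finset.prod_eq_single_of_mem p hp]
  intro l hl hlp
  obtain ⟨k, hk⟩ : l ∣ (∏ l ∈ P, l) / p := by
    rw [← Finset.mul_prod_erase P (fun l => l) hp, Nat.mul_div_cancel_left _ (hP p hp).pos]
    exact Finset.dvd_prod_of_mem (fun l => l) (Finset.mem_erase.2 ⟨hlp, hl⟩)
  rw [hk, pow_mul, hρ l hl, one_pow]

lemma squarefree_prod_primes {P : Finset ℕ} (hP : ∀ p ∈ P, p.Prime) :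
    Squarefree (∏ l ∈ P, l) := by
  refine Finset.squarefree_prod_of_pairwise_isCoprime ?_ fun p hp => (hP p hp).squarefree
  intro a ha b hb hab
  exact Nat.coprime_iff_isRelPrime.1 ((Nat.coprime_primes (hP a ha) (hP b hb)).2 hab)

/-- Let `A` be a subgroup of `G(q^n)` and `B = A ∩ F(q^n)`.  Then there
is a conjugate `A₁` of `A` in `G(q^n)` such that for every `x ∈ A \ B` of prime order
`q_x` there is `σ ∈ A₁ ∩ Gal(q^n)` with `σ ≠ 1` and `σ^{q_x} = 1`.

`F(q^n)` and `Gal(q^n)` are the images of `Kˣ` and `K ≃ₐ[F] K` in the semidirect product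
`G(q^n)`, i.e. the ranges of `inl` and `inr`. -/
theorem stmt_6 (F K : Type*) [Field F] [Field K] [Fintype F] [Fintype K] [Algebra F K]
    (q n : ℕ) (hq : Fintype.card F = q) (hK : Fintype.card K = q ^ n)
    (A : Subgroup (Kˣ ⋊[galAct F K] (K ≃ₐ[F] K))) :
    ∃ g : Kˣ ⋊[galAct F K] (K ≃ₐ[F] K),
      ∀ x ∈ A, x ∉ (inl : Kˣ →* Kˣ ⋊[galAct F K] (K ≃ₐ[F] K)).range →
        ∀ qx : ℕ, qx.Prime → orderOf x = qx →
          ∃ σ, σ ∈ A.map (MulAut.conj g).toMonoidHom ∧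
            σ ∈ (inr : (K ≃ₐ[F] K) →* Kˣ ⋊[galAct F K] (K ≃ₐ[F] K)).range ∧
            σ ≠ 1 ∧ σ ^ qx = 1 := by
  classical
  let P : Finset ℕ := (Nat.card (K ≃ₐ[F] K)).primeFactors.filter
    fun p => ∃ x ∈ A, x.right ≠ 1 ∧ x ^ p = 1
  have hP (p : ℕ) (hp : p ∈ P) : p.Prime :=
    Nat.prime_of_mem_primeFactors (Finset.mem_filter.1 hp).1
  choose! x hxA hx1 hxp using fun p (hp : p ∈ P) => (Finset.mem_filter.1 hp).2
  have hρ (p : ℕ) (hp : p ∈ P) : (x p).right ^ p = 1 := by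
    rw [← SemidirectProduct.pow_right, hxp p hp, one_right]
  let _ : CommGroup (K ≃ₐ[F] K) := IsCyclic.commGroup
  set m := ∏ l ∈ P, l with hm
  have hsq : Squarefree m := squarefree_prod_primes hP
  set σ := ∏ l ∈ P, (x l).right with hσ
  have hσA : σ ∈ A.map rightHom :=
    Subgroup.prod_mem _ fun p hp => ⟨x p, hxA p hp, rfl⟩
  have hσp (p : ℕ) (hp : p ∈ P) : σ ^ (m / p) = (x p).right ^ (m / p) :=
    prod_pow_prod_div hP hρ hp
  have hmem (p : ℕ) (hp : p.Prime) (hpm : p ∣ m) : p ∈ P := by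
    obtain ⟨l, hl, hpl⟩ := (Prime.dvd_finsetProd_iff hp.prime _).1 hpm
    rwa [(Nat.prime_dvd_prime_iff_eq hp (hP l hl)).1 hpl]
  have hne (p : ℕ) (hp : p.Prime) (hpm : p ∣ m) : σ ^ (m / p) ≠ 1 := by
    have hpP := hmem p hp hpm
    have := Fact.mk hp
    rw [hσp p hpP, Ne, ← orderOf_dvd_iff_pow_eq_one,
      orderOf_eq_prime (hρ p hpP) (hx1 p hpP)]
    intro hdvd
    exact hp.one_lt.ne' (Nat.isUnit_iff.1 (hsq p
      ((mul_dvd_mul_left p hdvd).trans (Nat.mul_div_cancel' hpm).dvd)))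
  have hσm : σ ^ m = 1 := by
    rw [hσ, ← Finset.prod_pow]
    refine Finset.prod_eq_one fun p hp => ?_
    rw [← orderOf_dvd_iff_pow_eq_one]
    exact (orderOf_dvd_of_pow_eq_one (hρ p hp)).trans (Finset.dvd_prod_of_mem id hp)
  have hord : orderOf σ = m :=
    orderOf_eq_of_pow_and_pow_div_prime (Nat.pos_of_ne_zero hsq.ne_zero) hσm hne
  obtain ⟨y, hyA, hyσ, hym⟩ := exists_pow_eq_one_of_forall_prime hsq hσA hσm
    fun p hp hpm => ⟨x p ^ (m / p), A.pow_mem (hxA p (hmem p hp hpm)) _,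
      by rw [SemidirectProduct.pow_right, hσp p (hmem p hp hpm)],
      by rw [← pow_mul, mul_comm, pow_mul, hxp p (hmem p hp hpm), one_pow]⟩
  have hy : orderOf y.right = m := by rw [hyσ, hord]
  obtain ⟨g, hg⟩ := exists_conj_eq_inr (y := y)
    (by rw [hy]; exact Nat.pos_of_ne_zero hsq.ne_zero) (by rw [hy, hym])
  refine ⟨g, fun a ha haB p hp hap => ?_⟩
  have ha1 : a.right ≠ 1 := fun h => haB (by
    rw [range_inl_eq_ker_rightHom, MonoidHom.mem_ker, rightHom_eq_right, h])
  have hap' : a ^ p = 1 := hap ▸ pow_orderOf_eq_one a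
  have hpP : p ∈ P := by
    have := Fact.mk hp
    refine Finset.mem_filter.2 ⟨Nat.mem_primeFactors.2 ⟨hp, ?_, Nat.card_pos.ne'⟩, a, ha, ha1, hap'⟩
    have har : a.right ^ p = 1 := by rw [← SemidirectProduct.pow_right, hap', one_right]
    exact orderOf_eq_prime har ha1 ▸ orderOf_dvd_natCard a.right
  have hpm : p ∣ m := Finset.dvd_prod_of_mem id hpP
  refine ⟨inr (σ ^ (m / p)), ⟨y ^ (m / p), A.pow_mem hyA _, ?_⟩, ⟨_, rfl⟩, ?_, ?_⟩
  · rw [MulEquiv.coe_toMonoidHom, map_pow, hg, hyσ, map_pow]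
  · rw [Ne, map_eq_one_iff _ inr_injective]
    exact hne p hp hpm
  · rw [← map_pow, ← pow_mul, Nat.div_mul_cancel hpm, hσm, map_one]
end

section
/- G(q^n) acts naturally on F(q^n), with F(q^n) acting by multiplication and Gal(q^n) acting in its natural way. Let A ⊆ G(q^n) be a subgroup and B = A ∩ F(q^n). Then the following are equivalent: (A) A has a regular orbit on F(q^n); (B) for every prime s, GN(q^n, s) is not conjugate in G(q^n) to a subgroup of A; (C) for every prime s such that A \ B has an element of order s, choosing σ_s ∈ Gal(q^n) of order s and setting N_s = {x ∈ F(q^n) : N_{σ_s}(x) = 1}, one has N_s ⊄ B. -/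
open SemidirectProduct

open Finset in
/-- In a finite cyclic group, elements whose order divides that of `a` are powers of `a`. -/
theorem mem_zpowers_of_pow_orderOf_eq_one {Γ : Type*} [Group Γ] [Finite Γ] [IsCyclic Γ]
    {a b : Γ} (h : b ^ orderOf a = 1) : b ∈ Subgroup.zpowers a := by
  classical
  have := Fintype.ofFinite Γ
  have hsub : (Subgroup.zpowers a : Set Γ).toFinset ⊆ ({x : Γ | x ^ orderOf a = 1} : Finset Γ) := by
    intro x hx
    obtain ⟨k, rfl⟩ : x ∈ Subgroup.zpowers a := by simpa using hx
    simp only [mem_filter, mem_univ, true_and]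
    rw [← zpow_natCast, ← zpow_mul, mul_comm, zpow_mul, zpow_natCast, pow_orderOf_eq_one, one_zpow]
  have hle : #({x : Γ | x ^ orderOf a = 1} : Finset Γ) ≤
      #(Subgroup.zpowers a : Set Γ).toFinset := by
    refine (IsCyclic.card_pow_eq_one_le (orderOf_pos a)).trans (le_of_eq ?_)
    rw [Set.toFinset_card, ← Nat.card_eq_fintype_card]
    exact (Nat.card_zpowers a).symm
  have hb : b ∈ (Subgroup.zpowers a : Set Γ).toFinset := by
    rw [eq_of_subset_of_card_le hsub hle]
    simpa using h
  simpa using hb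

/-- A proper subgroup of a finite cyclic group consists of `r`-th powers, for some prime `r`
dividing the order of the group. -/
theorem exists_prime_forall_mem_exists_pow_eq {C : Type*} [CommGroup C] [Finite C] [IsCyclic C]
    {H : Subgroup C} (hH : H ≠ ⊤) :
    ∃ r : ℕ, r.Prime ∧ r ∣ Nat.card C ∧ ∀ z ∈ H, ∃ w : C, w ^ r = z := by
  obtain ⟨g, hg⟩ := IsCyclic.exists_generator (α := C)
  have hne : H.index ≠ 1 := by rwa [Ne, Subgroup.index_eq_one]
  obtain ⟨r, hr, hrd⟩ := Nat.exists_prime_and_dvd hne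
  refine ⟨r, hr, hrd.trans H.index_dvd_card, fun z hz => ?_⟩
  obtain ⟨k, rfl⟩ := hg z
  have hgen : ∀ x : C ⧸ H, x ∈ Subgroup.zpowers (g : C ⧸ H) := by
    intro x
    obtain ⟨y, rfl⟩ := QuotientGroup.mk_surjective x
    obtain ⟨m, rfl⟩ := hg y
    exact ⟨m, rfl⟩
  have hord : orderOf (g : C ⧸ H) = H.index := orderOf_eq_card_of_forall_mem_zpowers hgen
  have h1 : (g : C ⧸ H) ^ k = 1 := (QuotientGroup.eq_one_iff (g ^ k)).2 hz
  have h2 : (r : ℤ) ∣ k := (Int.natCast_dvd_natCast.2 (hord ▸ hrd)).trans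
    (orderOf_dvd_iff_zpow_eq_one.2 h1)
  obtain ⟨m, rfl⟩ := h2
  exact ⟨g ^ m, by rw [← zpow_natCast, ← zpow_mul, mul_comm]⟩

/-- If a power `g ^ k` of a generator of a cyclic group is an `r`-th power, `r` dividing the order
of the group, then `r ∣ k`. -/
theorem dvd_of_pow_eq_zpow {C : Type*} [CommGroup C] {g : C}
    (hg : ∀ x, x ∈ Subgroup.zpowers g) {r : ℕ} (hr : r ∣ Nat.card C) {k : ℤ} {w : C}
    (h : w ^ r = g ^ k) : (r : ℤ) ∣ k := by
  obtain ⟨m, rfl⟩ := hg w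
  have h1 : g ^ (m * r - k) = 1 := by
    rw [zpow_sub, zpow_mul, zpow_natCast, h, mul_inv_cancel]
  have h2 : (r : ℤ) ∣ m * r - k := (Int.natCast_dvd_natCast.2
    (orderOf_eq_card_of_forall_mem_zpowers hg ▸ hr)).trans (orderOf_dvd_iff_zpow_eq_one.2 h1)
  exact (dvd_sub_right (dvd_mul_left _ _)).1 h2

/-- In a finite cyclic group one can avoid, simultaneously for all primes `r` dividing the order,
a prescribed coset of the subgroup of `r`-th powers. -/
theorem exists_forall_prime_pow_ne_div {C : Type*} [CommGroup C] [Finite C] [IsCyclic C]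
    (f : ℕ → C) :
    ∃ x : C, ∀ r : ℕ, r.Prime → r ∣ Nat.card C → ∀ w : C, w ^ r ≠ x / f r := by
  obtain ⟨g, hg⟩ := IsCyclic.exists_generator (α := C)
  have hf : ∀ r, ∃ k : ℕ, g ^ k = f r := fun r =>
    (mem_powers_iff_mem_zpowers.2 (hg (f r)))
  choose k hk using hf
  obtain ⟨m, hm⟩ := Nat.chineseRemainderOfFinset (fun r => k r + 1) id (Nat.card C).primeFactors
    (fun r hr => (Nat.prime_of_mem_primeFactors hr).ne_zero)
    (fun r hr t ht hrt => (Nat.coprime_primes (Nat.prime_of_mem_primeFactors hr)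
      (Nat.prime_of_mem_primeFactors ht)).2 hrt)
  refine ⟨g ^ m, fun r hr hrc w hw => ?_⟩
  rw [← hk, ← zpow_natCast g m, ← zpow_natCast g (k r), div_eq_mul_inv, ← zpow_sub] at hw
  have h1 := dvd_of_pow_eq_zpow hg hrc hw
  have h2 := (Nat.modEq_iff_dvd.1 (hm r (Nat.mem_primeFactors.2 ⟨hr, hrc, Nat.card_pos.ne'⟩)))
  simp only [id, Nat.cast_add, Nat.cast_one] at h2
  have h3 : (r : ℤ) ∣ 1 := by
    have := dvd_add h1 h2
    ring_nf at this
    exact this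
  exact hr.one_lt.ne' (by exact_mod_cast Int.eq_one_of_dvd_one (by positivity) h3)

section

variable {C Γ : Type*} [CommGroup C] [Group Γ] (φ : Γ →* MulAut C)

/-- The homomorphism `z ↦ z / σ z`. -/
def divHom (σ : Γ) : C →* C where
  toFun z := z / φ σ z
  map_one' := by simp
  map_mul' x y := by rw [map_mul, mul_div_mul_comm]

/-- The elements `z` with `z / σ z ∈ A`. -/
def divComap (A : Subgroup (C ⋊[φ] Γ)) (σ : Γ) : Subgroup C :=
  (A.comap inl).comap (divHom φ σ)

variable {φ}

theorem mem_divComap {A : Subgroup (C ⋊[φ] Γ)} {σ : Γ} {z : C} :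
    z ∈ divComap φ A σ ↔ (inl (z / φ σ z) : C ⋊[φ] Γ) ∈ A := Iff.rfl

theorem mk_div_mem_iff {A : Subgroup (C ⋊[φ] Γ)} {σ : Γ} {x y : C}
    (hx : (⟨x / φ σ x, σ⟩ : C ⋊[φ] Γ) ∈ A) :
    (⟨y / φ σ y, σ⟩ : C ⋊[φ] Γ) ∈ A ↔ y / x ∈ divComap φ A σ := by
  have h : (⟨y / φ σ y, σ⟩ : C ⋊[φ] Γ) =
      inl (y / x / φ σ (y / x)) * ⟨x / φ σ x, σ⟩ := by
    ext
    · simp only [mul_left, left_inl, right_inl, map_one, MulAut.one_apply]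
      rw [map_div, div_div_div_comm, div_mul_cancel]
    · simp only [mul_right, right_inl, one_mul]
  rw [h, mem_divComap, A.mul_mem_cancel_right hx]

theorem mk_div_pow (σ : Γ) (x : C) (k : ℕ) :
    (⟨x / φ σ x, σ⟩ : C ⋊[φ] Γ) ^ k = ⟨x / φ (σ ^ k) x, σ ^ k⟩ := by
  induction k with
  | zero => ext <;> simp
  | succ k ih =>
    rw [pow_succ, ih]
    ext
    · simp only [mul_left, map_div, pow_succ, map_mul, MulAut.mul_apply, div_mul_div_cancel]
    · simp only [mul_right, pow_succ]

/-- Powers of `(x / σ x, σ)` are of the same shape. -/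
theorem mk_div_mem_of_mem_zpowers [Finite Γ] {A : Subgroup (C ⋊[φ] Γ)} {σ τ : Γ} {x : C}
    (hx : (⟨x / φ σ x, σ⟩ : C ⋊[φ] Γ) ∈ A) (h : τ ∈ Subgroup.zpowers σ) :
    (⟨x / φ τ x, τ⟩ : C ⋊[φ] Γ) ∈ A := by
  obtain ⟨k, rfl⟩ := mem_powers_iff_mem_zpowers.2 h
  have := A.pow_mem hx k
  rwa [mk_div_pow] at this

theorem div_mem_divComap_of_comm {A : Subgroup (C ⋊[φ] Γ)} {σ τ : Γ} (hc : σ * τ = τ * σ) {x y : C}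
    (hx : (⟨x / φ σ x, σ⟩ : C ⋊[φ] Γ) ∈ A) (hy : (⟨y / φ τ y, τ⟩ : C ⋊[φ] Γ) ∈ A) :
    x / y / φ σ (x / y) ∈ divComap φ A τ := by
  have hc' : φ σ (φ τ y) = φ τ (φ σ y) := by
    rw [← MulAut.mul_apply, ← map_mul, hc, map_mul, MulAut.mul_apply]
  have h : (inl (x / y / φ σ (x / y) / φ τ (x / y / φ σ (x / y))) : C ⋊[φ] Γ) *
      (⟨y / φ τ y, τ⟩ * ⟨x / φ σ x, σ⟩) = ⟨x / φ σ x, σ⟩ * ⟨y / φ τ y, τ⟩ := by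
    ext
    · simp only [mul_left, left_inl, right_inl, map_one, MulAut.one_apply]
      simp only [map_div, hc']
      have key : ∀ {M : Type _} [AddCommGroup M] (x y a b c d m n : M),
          x - y - (a - b) - (c - d - (m - n)) + (y - d + (c - m)) = x - a + (b - n) := by
        intros; abel
      exact key (M := Additive C) x y (φ σ x) (φ σ y) (φ τ x) (φ τ y) (φ τ (φ σ x)) (φ τ (φ σ y))
    · simp only [mul_right, right_inl, one_mul, hc]
  rw [mem_divComap, ← A.mul_mem_cancel_right (A.mul_mem hy hx), h]
  exact A.mul_mem hx hy

/-- If all `z` with `z / σ z ∈ A` are `r`-th powers, then either `r` is the order of `σ`, or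
`z` is an `r`-th power whenever `z / σ z` is one. -/
theorem eq_orderOf_or_exists_pow_eq [Finite C] [IsCyclic C] {A : Subgroup (C ⋊[φ] Γ)} {σ : Γ}
    (hσ : (orderOf σ).Prime) {r : ℕ} (hr : r.Prime) (hrc : r ∣ Nat.card C)
    (hA : ∀ z ∈ divComap φ A σ, ∃ w : C, w ^ r = z) :
    r = orderOf σ ∨ ∀ z w : C, w ^ r = z / φ σ z → ∃ w : C, w ^ r = z := by
  obtain ⟨g, hg⟩ := IsCyclic.exists_generator (α := C)
  obtain ⟨e, he⟩ := MonoidHom.map_cyclic (φ σ : C ≃* C).toMonoidHom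
  replace he : ∀ z, φ σ z = z ^ e := he
  have hpow : ∀ (i : ℕ) (z : C), φ (σ ^ i) z = z ^ (e ^ i) := by
    intro i z
    induction i with
    | zero => simp
    | succ i ih => rw [pow_succ', map_mul, MulAut.mul_apply, ih, he, ← zpow_mul, pow_succ]
  by_cases hd : (r : ℤ) ∣ e - 1
  · left
    set s := orderOf σ with hs
    obtain ⟨w, hw⟩ := hA (g ^ (∑ i ∈ Finset.range s, e ^ i)) (by
      rw [mem_divComap, he, ← zpow_mul, div_eq_mul_inv, ← zpow_sub]
      have : (∑ i ∈ Finset.range s, e ^ i) - (∑ i ∈ Finset.range s, e ^ i) * e = 1 - e ^ s := by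
        linear_combination -geom_sum_mul e s
      rw [this, zpow_sub, ← hpow, hs, pow_orderOf_eq_one]
      simp)
    have h1 := dvd_of_pow_eq_zpow hg hrc hw
    have h2 : (∑ i ∈ Finset.range s, e ^ i) ≡ s [ZMOD r] := by
      have : ∀ i ∈ Finset.range s, e ^ i ≡ 1 [ZMOD r] := fun i _ => by
        simpa using (Int.modEq_iff_dvd.2 hd).symm.pow i
      simpa using Int.ModEq.sum this
    have h3 : (r : ℤ) ∣ s := h2.dvd_iff.1 h1
    exact (Nat.prime_dvd_prime_iff_eq hr hσ).1 (Int.natCast_dvd_natCast.1 h3)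
  · right
    intro z w hw
    obtain ⟨k, rfl⟩ := hg z
    simp only at hw ⊢
    rw [he, ← zpow_mul, div_eq_mul_inv, ← zpow_sub] at hw
    have h1 := dvd_of_pow_eq_zpow hg hrc hw
    have h2 : (r : ℤ) ∣ k * (e - 1) := by
      rwa [show k * (e - 1) = -(k - k * e) by ring, dvd_neg]
    obtain ⟨m, rfl⟩ := ((Nat.prime_iff_prime_int.1 hr).dvd_or_dvd h2).resolve_right hd
    exact ⟨g ^ m, by rw [← zpow_natCast, ← zpow_mul, mul_comm]⟩

theorem exists_pow_eq_div [Finite C] [IsCyclic C] [Finite Γ] [IsCyclic Γ]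
    {A : Subgroup (C ⋊[φ] Γ)} {σ τ : Γ} (hσ : (orderOf σ).Prime) (hτ : (orderOf τ).Prime)
    {x y : C}
    (hx : (⟨x / φ σ x, σ⟩ : C ⋊[φ] Γ) ∈ A) (hy : (⟨y / φ τ y, τ⟩ : C ⋊[φ] Γ) ∈ A)
    {r : ℕ} (hr : r.Prime) (hrc : r ∣ Nat.card C)
    (hAσ : ∀ z ∈ divComap φ A σ, ∃ w : C, w ^ r = z)
    (hAτ : ∀ z ∈ divComap φ A τ, ∃ w : C, w ^ r = z) : ∃ w : C, w ^ r = x / y := by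
  have hc : σ * τ = τ * σ := IsCyclic.commGroup.mul_comm σ τ
  rcases eq_orderOf_or_exists_pow_eq hσ hr hrc hAσ with h | h
  · rcases eq_orderOf_or_exists_pow_eq hτ hr hrc hAτ with h' | h'
    · have hmem : τ ∈ Subgroup.zpowers σ := mem_zpowers_of_pow_orderOf_eq_one (by
        rw [← h, h', pow_orderOf_eq_one])
      exact hAτ _ ((mk_div_mem_iff hy).1 (mk_div_mem_of_mem_zpowers hx hmem))
    · obtain ⟨w, hw⟩ := hAσ _ (div_mem_divComap_of_comm hc.symm hy hx)
      obtain ⟨v, hv⟩ := h' _ w hw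
      exact ⟨v⁻¹, by rw [inv_pow, hv, inv_div]⟩
  · obtain ⟨w, hw⟩ := hAτ _ (div_mem_divComap_of_comm hc hx hy)
    exact h _ w hw

/-- If every `x` lies in one of the sets `{x | (x / σ x, σ) ∈ A}`, `σ` of prime order, then one of
these sets is everything. -/
theorem exists_forall_mk_div_mem [Finite C] [IsCyclic C] [Finite Γ] [IsCyclic Γ]
    {A : Subgroup (C ⋊[φ] Γ)}
    (h : ∀ x : C, ∃ σ : Γ, (orderOf σ).Prime ∧ (⟨x / φ σ x, σ⟩ : C ⋊[φ] Γ) ∈ A) :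
    ∃ σ : Γ, (orderOf σ).Prime ∧ ∀ x : C, (⟨x / φ σ x, σ⟩ : C ⋊[φ] Γ) ∈ A := by
  classical
  by_contra! hcon
  have hne : ∀ σ : Γ, (orderOf σ).Prime → ∀ x, (⟨x / φ σ x, σ⟩ : C ⋊[φ] Γ) ∈ A →
      divComap φ A σ ≠ ⊤ := by
    intro σ hσ x hx htop
    obtain ⟨y, hy⟩ := hcon σ hσ
    exact hy ((mk_div_mem_iff hx).2 (htop ▸ Subgroup.mem_top _))
  let P : ℕ → C → Prop := fun r x => ∃ σ : Γ, (orderOf σ).Prime ∧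
    (⟨x / φ σ x, σ⟩ : C ⋊[φ] Γ) ∈ A ∧ ∀ z ∈ divComap φ A σ, ∃ w : C, w ^ r = z
  have hf : ∀ r, ∃ y, (∃ x, P r x) → P r y := fun r => by
    by_cases hP : ∃ x, P r x
    · exact hP.imp fun x hx _ => hx
    · exact ⟨1, fun h => absurd h hP⟩
  choose f hf using hf
  obtain ⟨x, hx⟩ := exists_forall_prime_pow_ne_div f
  obtain ⟨σ, hσ, hxσ⟩ := h x
  obtain ⟨r, hr, hrc, hrσ⟩ := exists_prime_forall_mem_exists_pow_eq (hne σ hσ x hxσ)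
  obtain ⟨τ, hτ, hyτ, hrτ⟩ := hf r ⟨x, σ, hσ, hxσ, hrσ⟩
  obtain ⟨w, hw⟩ := exists_pow_eq_div hσ hτ hxσ hyτ hr hrc hrσ hrτ
  exact hx r hr hrc w hw

end

/-- Hilbert's Theorem 90 for an automorphism `σ` of finite order. -/
theorem exists_div_eq_of_prod_range_orderOf_eq_one {F K : Type*} [Field F] [Field K] [Algebra F K]
    {σ : K ≃ₐ[F] K} (hσ : 0 < orderOf σ) {x : Kˣ}
    (hx : ∏ i ∈ Finset.range (orderOf σ), (σ ^ i) (x : K) = 1) :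
    ∃ y : Kˣ, y / galAct F K σ y = x := by
  set s := orderOf σ with hs
  let c : ℕ → K := fun i => ∏ j ∈ Finset.range i, (σ ^ j) (x : K)
  have hc : ∀ i, x * σ (c i) = c (i + 1) := fun i => by
    simp only [c, Finset.prod_range_succ', map_prod]
    rw [mul_comm]
    simp [pow_succ']
  let ψ : Fin s → (K →* K) := fun i => ((σ ^ (i : ℕ) : K ≃ₐ[F] K) : K →* K)
  have hψ : Function.Injective ψ := by
    intro i j hij
    apply Fin.ext
    apply pow_injOn_Iio_orderOf i.2 j.2
    ext z
    exact DFunLike.congr_fun hij z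
  have hlin := (linearIndependent_monoidHom K K).comp ψ hψ
  obtain ⟨z, hz⟩ : ∃ z : K, ∑ i ∈ Finset.range s, c i * (σ ^ i) z ≠ 0 := by
    by_contra! h
    have h0 := Fintype.linearIndependent_iff.1 hlin (fun i => c i) (by
      ext z
      rw [Finset.sum_apply]
      simpa [ψ, Finset.sum_range] using h z) ⟨0, hσ⟩
    simp [c] at h0
  set y := ∑ i ∈ Finset.range s, c i * (σ ^ i) z with hy
  have hxy : x * σ y = y := by
    have h1 : x * σ y = ∑ i ∈ Finset.range s, c (i + 1) * (σ ^ (i + 1)) z := by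
      rw [hy, map_sum, Finset.mul_sum]
      refine Finset.sum_congr rfl fun i _ => ?_
      rw [← hc, map_mul, pow_succ', AlgEquiv.mul_apply, mul_assoc]
    have h2 := Finset.sum_range_succ' (fun i => c i * (σ ^ i) z) s
    rw [Finset.sum_range_succ] at h2
    have h3 : c s * (σ ^ s) z = c 0 * (σ ^ 0) z := by
      rw [hs, pow_orderOf_eq_one, pow_zero]
      congr 1
    rw [h1, hy]
    rw [h3] at h2
    exact (add_right_cancel h2).symm
  refine ⟨Units.mk0 y hz, ?_⟩
  rw [div_eq_iff_eq_mul]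
  ext
  exact hxy.symm

theorem left_pow_eq_prod {C Γ : Type*} [CommGroup C] [Group Γ] {φ : Γ →* MulAut C}
    (g : C ⋊[φ] Γ) (k : ℕ) :
    (g ^ k).left = ∏ i ∈ Finset.range k, φ (g.right ^ i) g.left := by
  induction k with
  | zero => simp
  | succ k ih =>
    have : (g ^ k).right = g.right ^ k := map_pow rightHom g k
    rw [pow_succ, mul_left, ih, Finset.prod_range_succ, this]

section

variable {F K : Type*} [Field F] [Field K] [Algebra F K]

theorem coe_galAct (σ : K ≃ₐ[F] K) (x : Kˣ) : (galAct F K σ x : K) = σ x := rfl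

theorem prod_range_eq_one_of_pow_eq_one {g : Kˣ ⋊[galAct F K] (K ≃ₐ[F] K)} {s : ℕ}
    (h : g ^ s = 1) : ∏ i ∈ Finset.range s, (g.right ^ i) (g.left : K) = 1 := by
  have h1 := left_pow_eq_prod g s
  rw [h, one_left] at h1
  have h2 := congrArg Units.val h1
  rw [Units.coe_prod, Units.val_one] at h2
  exact h2.symm

theorem finprod_zpowers_eq_prod_range [Finite (K ≃ₐ[F] K)] (σ : K ≃ₐ[F] K) (x : K) :
    ∏ᶠ τ : Subgroup.zpowers σ, (τ : K ≃ₐ[F] K) x =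
      ∏ i ∈ Finset.range (orderOf σ), (σ ^ i) x := by
  have := Fintype.ofFinite (Subgroup.zpowers σ)
  rw [finprod_eq_prod_of_fintype, Finset.prod_range]
  exact (Fintype.prod_equiv (finEquivZPowers (isOfFinOrder_of_finite σ)) _ _
    fun i => by rw [finEquivZPowers_apply]).symm

theorem finprod_subgroup_apply_apply (A' : Subgroup (K ≃ₐ[F] K)) {σ : K ≃ₐ[F] K}
    (hσ : σ ∈ A') (x : K) :
    ∏ᶠ τ : A', (τ : K ≃ₐ[F] K) (σ x) = ∏ᶠ τ : A', (τ : K ≃ₐ[F] K) x :=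
  finprod_eq_of_bijective _ (Equiv.mulRight (⟨σ, hσ⟩ : A')).bijective fun _ => rfl

/-- The subgroup `A' ⋉ {x | ∏_{τ ∈ A'} τ x = 1}`. -/
def galNormOne [Finite (K ≃ₐ[F] K)] (A' : Subgroup (K ≃ₐ[F] K)) :
    Subgroup (Kˣ ⋊[galAct F K] (K ≃ₐ[F] K)) where
  carrier := {g | g.right ∈ A' ∧ ∏ᶠ τ : A', (τ : K ≃ₐ[F] K) (g.left : K) = 1}
  one_mem' := ⟨A'.one_mem, by simp⟩
  mul_mem' := by
    rintro g h ⟨hg, hg'⟩ ⟨hh, hh'⟩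
    refine ⟨A'.mul_mem hg hh, ?_⟩
    simp only [mul_left, Units.val_mul, map_mul, coe_galAct]
    rw [finprod_mul_distrib (Set.toFinite _) (Set.toFinite _), hg',
      finprod_subgroup_apply_apply A' hg, hh', one_mul]
  inv_mem' := by
    rintro g ⟨hg, hg'⟩
    refine ⟨A'.inv_mem hg, ?_⟩
    rw [inv_left, coe_galAct, finprod_subgroup_apply_apply A' (A'.inv_mem hg)]
    simp [finprod_inv_distrib, hg']

variable {A : Subgroup (Kˣ ⋊[galAct F K] (K ≃ₐ[F] K))}

/-- If every point of `Kˣ` is fixed by a nontrivial element of `A`, there is `σ` of prime order such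
that `A` contains all the elements `(x / σ x, σ)`. -/
theorem exists_forall_mk_div_mem_of_fixed [Finite K]
    (h : ∀ x : Kˣ, ∃ g ∈ A, g.left * galAct F K g.right x = x ∧ g ≠ 1) :
    ∃ σ : K ≃ₐ[F] K, (orderOf σ).Prime ∧
      ∀ x : Kˣ, (⟨x / galAct F K σ x, σ⟩ : Kˣ ⋊[galAct F K] (K ≃ₐ[F] K)) ∈ A := by
  refine exists_forall_mk_div_mem fun x => ?_
  obtain ⟨⟨y, σ⟩, hg, hfix, hne⟩ := h x
  obtain rfl : y = x / galAct F K σ x := eq_div_iff_mul_eq'.2 hfix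
  have hσ : σ ≠ 1 := by
    rintro rfl
    apply hne
    ext <;> simp
  obtain ⟨s, hs, hsd⟩ := Nat.exists_prime_and_dvd (mt orderOf_eq_one_iff.1 hσ)
  have hord := orderOf_pow_orderOf_div (orderOf_pos σ).ne' hsd
  exact ⟨σ ^ (orderOf σ / s), hord.symm ▸ hs,
    mk_div_mem_of_mem_zpowers hg (Subgroup.npow_mem_zpowers σ _)⟩

theorem inr_mem_of_forall_mk_div_mem {σ : K ≃ₐ[F] K}
    (h : ∀ x : Kˣ, (⟨x / galAct F K σ x, σ⟩ : Kˣ ⋊[galAct F K] (K ≃ₐ[F] K)) ∈ A) :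
    (inr σ : Kˣ ⋊[galAct F K] (K ≃ₐ[F] K)) ∈ A := by
  simpa using h 1

theorem inl_mem_of_forall_mk_div_mem [Finite K] {σ : K ≃ₐ[F] K}
    (h : ∀ x : Kˣ, (⟨x / galAct F K σ x, σ⟩ : Kˣ ⋊[galAct F K] (K ≃ₐ[F] K)) ∈ A)
    {x : Kˣ} (hx : ∏ i ∈ Finset.range (orderOf σ), (σ ^ i) (x : K) = 1) :
    (inl x : Kˣ ⋊[galAct F K] (K ≃ₐ[F] K)) ∈ A := by
  obtain ⟨y, rfl⟩ := exists_div_eq_of_prod_range_orderOf_eq_one (orderOf_pos σ) hx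
  have := h y
  rwa [mk_eq_inl_mul_inr, A.mul_mem_cancel_right (inr_mem_of_forall_mk_div_mem h)] at this

end

/-- `G(q^n)` acts naturally on `F(q^n)` (the `F(q^n)`-part by
multiplication, the Galois part naturally); this action is the homomorphism
`act : G(q^n) →* Equiv.Perm Kˣ` with `act (x, σ) y = x * σ(y)`.  For a subgroup
`A ≤ G(q^n)` with `B = A ∩ F(q^n)`, the following are equivalent:

(A) `A` has a regular orbit on `F(q^n)`;

(B) for every prime `s` (dividing `n`, so that `GN(q^n,s)` is defined), `GN(q^n, s)` is
not conjugate in `G(q^n)` to a subgroup of `A`;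

(C) for every prime `s` such that `A \ B` has an element of order `s`, for `σ_s ∈ Gal(q^n)`
of order `s` and `N_s = {x ∈ F(q^n) : N_{σ_s}(x) = 1}`, one has `N_s ⊄ B`. -/
theorem stmt_7 (F K : Type*) [Field F] [Field K] [Fintype F] [Fintype K] [Algebra F K]
    (q n : ℕ) (hq : Fintype.card F = q) (hK : Fintype.card K = q ^ n)
    (act : (Kˣ ⋊[galAct F K] (K ≃ₐ[F] K)) →* Equiv.Perm Kˣ)
    (hact : ∀ (g : Kˣ ⋊[galAct F K] (K ≃ₐ[F] K)) (x : Kˣ),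
      act g x = g.left * galAct F K g.right x)
    (A : Subgroup (Kˣ ⋊[galAct F K] (K ≃ₐ[F] K))) :
    ((∃ x : Kˣ, ∀ g ∈ A, act g x = x → g = 1) ↔
      (∀ s : ℕ, s.Prime → s ∣ n →
        ∀ A' : Subgroup (K ≃ₐ[F] K), Nat.card A' = s →
          ∀ GN : Subgroup (Kˣ ⋊[galAct F K] (K ≃ₐ[F] K)),
            (∀ g : Kˣ ⋊[galAct F K] (K ≃ₐ[F] K),
              g ∈ GN ↔ g.right ∈ A' ∧ ∏ᶠ τ : A', (τ : K ≃ₐ[F] K) (g.left : K) = 1) →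
            ∀ c : Kˣ ⋊[galAct F K] (K ≃ₐ[F] K),
              ¬ GN.map (MulAut.conj c).toMonoidHom ≤ A)) ∧
    ((∃ x : Kˣ, ∀ g ∈ A, act g x = x → g = 1) ↔
      (∀ s : ℕ, s.Prime →
        (∃ x ∈ A, x ∉ (inl : Kˣ →* Kˣ ⋊[galAct F K] (K ≃ₐ[F] K)).range ∧ orderOf x = s) →
        ∀ σs : K ≃ₐ[F] K, orderOf σs = s →
          ¬ ∀ x : Kˣ, (∏ i ∈ Finset.range s, (σs ^ i) (x : K) = 1) →
            (inl x : Kˣ ⋊[galAct F K] (K ≃ₐ[F] K)) ∈ A)) := by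
  classical
  have hact' : ∀ (σ : K ≃ₐ[F] K) (x : Kˣ), act ⟨x / galAct F K σ x, σ⟩ x = x := fun σ x => by
    rw [hact, div_mul_cancel]
  have hfail : (¬ ∃ x : Kˣ, ∀ g ∈ A, act g x = x → g = 1) → ∃ σ : K ≃ₐ[F] K, (orderOf σ).Prime ∧
      ∀ x : Kˣ, (⟨x / galAct F K σ x, σ⟩ : Kˣ ⋊[galAct F K] (K ≃ₐ[F] K)) ∈ A := fun h => by
    push Not at h
    simp only [hact] at h
    exact exists_forall_mk_div_mem_of_fixed h
  refine ⟨⟨?_, fun hB => ?_⟩, ⟨?_, fun hC => ?_⟩⟩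
  · rintro ⟨x, hx⟩ s hs - A' hA' GN hGN c hc
    have hnt : A' ≠ ⊥ := by
      rintro rfl
      rw [Subgroup.card_bot] at hA'
      exact hs.one_lt.ne hA'
    obtain ⟨σ, hσ, hσ1⟩ := A'.bot_or_exists_ne_one.resolve_left hnt
    set y := act c⁻¹ x with hy
    have hg : (⟨y / galAct F K σ y, σ⟩ : Kˣ ⋊[galAct F K] (K ≃ₐ[F] K)) ∈ GN := by
      refine (hGN _).2 ⟨hσ, ?_⟩
      have hne : ∏ᶠ τ : A', (τ : K ≃ₐ[F] K) (y : K) ≠ 0 :=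
        finprod_induction (· ≠ 0) one_ne_zero (fun _ _ => mul_ne_zero) fun τ => by simp
      simp only [Units.val_div_eq_div_val, map_div₀, coe_galAct]
      rw [finprod_div_distrib (Set.toFinite _) (Set.toFinite _),
        finprod_subgroup_apply_apply A' hσ, div_self hne]
    have h1 := hx _ (hc (Subgroup.mem_map_of_mem _ hg)) (by
      simp only [MulEquiv.coe_toMonoidHom, MulAut.conj_apply, map_mul, Equiv.Perm.mul_apply]
      rw [← hy, hact', hy, ← Equiv.Perm.mul_apply, ← map_mul, mul_inv_cancel, map_one,
        Equiv.Perm.one_apply])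
    have h2 := (MulEquiv.map_eq_one_iff (MulAut.conj c)).1 h1
    exact hσ1 (congrArg SemidirectProduct.right h2)
  · by_contra hA
    obtain ⟨σ, hσ, h⟩ := hfail hA
    have hn : n = Module.finrank F K := by
      have h1 := Module.card_eq_pow_finrank (K := F) (V := K)
      rw [hK, hq] at h1
      exact Nat.pow_right_injective (hq ▸ Fintype.one_lt_card) h1
    refine hB _ hσ ?_ (Subgroup.zpowers σ) (Nat.card_zpowers σ) (galNormOne _)
      (fun _ => Iff.rfl) 1 ?_
    · rw [hn, ← IsGalois.card_aut_eq_finrank F K]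
      exact orderOf_dvd_natCard σ
    · rintro _ ⟨g, ⟨hg, hg'⟩, rfl⟩
      rw [finprod_zpowers_eq_prod_range] at hg'
      have h1 := inl_mem_of_forall_mk_div_mem h hg'
      have h2 := inr_mem_of_forall_mk_div_mem fun x => mk_div_mem_of_mem_zpowers (h x) hg
      simpa [inl_left_mul_inr_right] using A.mul_mem h1 h2
  · rintro ⟨x, hx⟩ s hs ⟨g, hg, hgr, hgs⟩ σ hσ hN
    have hr : g.right ≠ 1 := fun h => hgr (by
      rw [range_inl_eq_ker_rightHom]
      exact h)
    have hpow : g.right ^ s = 1 := by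
      have : (g ^ s).right = g.right ^ s := map_pow rightHom g s
      rw [← this, ← hgs, pow_orderOf_eq_one, one_right]
    have := Fact.mk hs
    have hord : orderOf g.right = s := orderOf_eq_prime hpow hr
    have hmem : σ ∈ Subgroup.zpowers g.right := mem_zpowers_of_pow_orderOf_eq_one (by
      rw [hord, ← hσ, pow_orderOf_eq_one])
    obtain ⟨k, rfl⟩ := mem_powers_iff_mem_zpowers.2 hmem
    have hright : (g ^ k).right = g.right ^ k := map_pow rightHom g k
    simp only [← hright] at hσ hN
    have h1 : (inl (g ^ k).left : Kˣ ⋊[galAct F K] (K ≃ₐ[F] K)) ∈ A :=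
      hN _ (prod_range_eq_one_of_pow_eq_one (by rw [← pow_mul, mul_comm, pow_mul, ← hgs,
        pow_orderOf_eq_one, one_pow]))
    have h2 : (inr (g ^ k).right : Kˣ ⋊[galAct F K] (K ≃ₐ[F] K)) ∈ A := by
      rw [← A.mul_mem_cancel_left h1, inl_left_mul_inr_right]
      exact A.pow_mem hg k
    have h3 := hN (x / galAct F K (g ^ k).right x) (prod_range_eq_one_of_pow_eq_one
      (g := ⟨x / galAct F K (g ^ k).right x, (g ^ k).right⟩) (by
        rw [mk_div_pow, ← hσ, pow_orderOf_eq_one]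
        ext <;> simp))
    have h4 := hx ⟨x / galAct F K (g ^ k).right x, (g ^ k).right⟩ (by
      rw [mk_eq_inl_mul_inr]
      exact A.mul_mem h3 h2) (hact' _ x)
    have h5 : (g ^ k).right = 1 := congrArg SemidirectProduct.right h4
    rw [h5, orderOf_one] at hσ
    exact hs.one_lt.ne hσ
  · by_contra hA
    obtain ⟨σ, hσ, h⟩ := hfail hA
    refine hC _ hσ ⟨inr σ, inr_mem_of_forall_mk_div_mem h, ?_, orderOf_injective inr inr_injective σ⟩
      σ rfl fun x => inl_mem_of_forall_mk_div_mem h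
    rw [range_inl_eq_ker_rightHom, MonoidHom.mem_ker, rightHom_inr]
    rintro rfl
    exact hσ.one_lt.ne' orderOf_one
end

section
/- Let q be a prime power, n ∈ ℕ, consider V = GF(q^n) as an n-dimensional vector space over GF(q), and let A ≤ Γ(V). Let B = A ∩ Γ_0(V) and let π = {r : r is a prime such that A \ B has an element of order r}. If A does not have a regular orbit on V, then there exists a prime s ∈ π such that for every v ∈ V there is an element of A of order s fixing v. -/
open SemidirectProduct

/-- A prime `t` dividing `1 + Q + ⋯ + Q ^ (r - 1)` with `r` prime is at least `r`. -/
theorem prime_le_of_dvd_geom_sum {Q r t : ℕ} (hr : r.Prime) (ht : t.Prime)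
    (h : t ∣ ∑ i ∈ Finset.range r, Q ^ i) : r ≤ t := by
  have := Fact.mk ht
  have h0 : ∑ i ∈ Finset.range r, (Q : ZMod t) ^ i = 0 := by
    have := (ZMod.natCast_eq_zero_iff _ t).2 h
    exact_mod_cast this
  by_cases h1 : (Q : ZMod t) = 1
  · have : ((r : ℕ) : ZMod t) = 0 := by simpa [h1] using h0
    exact ((Nat.prime_dvd_prime_iff_eq ht hr).1 ((ZMod.natCast_eq_zero_iff _ _).1 this)).ge
  · have hpow : (Q : ZMod t) ^ r = 1 := by
      have := geom_sum_mul (Q : ZMod t) r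
      rw [h0, zero_mul] at this
      exact sub_eq_zero.1 this.symm
    have hQ : (Q : ZMod t) ≠ 0 := by
      intro hQ
      rw [hQ, zero_pow hr.ne_zero] at hpow
      exact zero_ne_one hpow
    have := Fact.mk hr
    have hord : orderOf (Q : ZMod t) = r := orderOf_eq_prime hpow h1
    have hdvd : r ∣ t - 1 := hord ▸ ZMod.orderOf_dvd_card_sub_one hQ
    have := Nat.le_of_dvd (Nat.sub_pos_of_lt ht.one_lt) hdvd
    omega

/-- Finitely many residue classes, indexed by integers `r ≥ 2` and having prime moduli
`t r ≥ r`, do not cover the natural numbers. -/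
theorem exists_forall_not_modEq (P : Finset ℕ) (t c : ℕ → ℕ) (hP : ∀ r ∈ P, 2 ≤ r)
    (ht : ∀ r ∈ P, (t r).Prime) (hrt : ∀ r ∈ P, r ≤ t r) :
    ∃ k : ℕ, ∀ r ∈ P, ¬ k ≡ c r [MOD t r] := by
  classical
  have hd : ∀ p ∈ P.image t, ∃ d : ℕ, ∀ r ∈ P, t r = p → ¬ d ≡ c r [MOD p] := by
    intro p hp
    obtain ⟨r₀, hr₀, rfl⟩ := Finset.mem_image.1 hp
    have hpos := (ht r₀ hr₀).pos
    obtain ⟨d, hd, hdn⟩ : ∃ d ∈ Finset.range (t r₀),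
        d ∉ (Finset.Icc 2 (t r₀)).image (fun r => c r % t r₀) := by
      refine Finset.exists_mem_notMem_of_card_lt_card (Finset.card_image_le.trans_lt ?_)
      simp
      omega
    refine ⟨d, fun r hr hrp hmod => hdn (Finset.mem_image.2 ⟨r, ?_, ?_⟩)⟩
    · exact Finset.mem_Icc.2 ⟨hP r hr, hrp ▸ hrt r hr⟩
    · rw [← Nat.mod_eq_of_lt (Finset.mem_range.1 hd)]
      exact hmod.symm
  choose! d hd using hd
  have hprime : ∀ p ∈ P.image t, p.Prime := by
    simpa using ht
  obtain ⟨k, hk⟩ := Nat.chineseRemainderOfFinset d id (P.image t)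
    (fun p hp => (hprime p hp).ne_zero)
    (fun p hp p' hp' hne => (Nat.coprime_primes (hprime p hp) (hprime p' hp')).2 hne)
  refine ⟨k, fun r hr hmod => ?_⟩
  have hm := Finset.mem_image_of_mem t hr
  exact hd _ hm r hr rfl ((hk _ hm).symm.trans hmod)

/-- In a finite cyclic group, a generator has order `W.index` modulo the subgroup `W`. -/
theorem index_dvd_of_zpow_mem {G : Type*} [CommGroup G] {γ : G}
    (hγ : ∀ x, x ∈ Subgroup.zpowers γ) (W : Subgroup G) {k : ℤ} (hk : γ ^ k ∈ W) :
    (W.index : ℤ) ∣ k := by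
  have hord : orderOf (γ : G ⧸ W) = W.index := by
    refine orderOf_eq_card_of_forall_mem_zpowers fun x => ?_
    obtain ⟨y, rfl⟩ := QuotientGroup.mk_surjective x
    obtain ⟨j, rfl⟩ := hγ y
    exact ⟨j, rfl⟩
  rw [← hord, orderOf_dvd_iff_zpow_eq_one, ← QuotientGroup.mk_zpow]
  exact (QuotientGroup.eq_one_iff _).2 hk

/-- In a finite cyclic group, elements of equal order generate the same subgroup. -/
theorem zpowers_eq_of_orderOf_eq {G : Type*} [Group G] [Finite G] [IsCyclic G] {g h : G}
    (hgh : orderOf g = orderOf h) : Subgroup.zpowers g = Subgroup.zpowers h := by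
  obtain ⟨γ, hγ⟩ := IsCyclic.exists_generator (α := G)
  have hord := orderOf_eq_card_of_forall_mem_zpowers hγ
  have key : ∀ x : G, Subgroup.zpowers x =
      Subgroup.zpowers (γ ^ (Nat.card G / orderOf x)) := by
    intro x
    have hdvd := orderOf_dvd_natCard x
    have hmul := Nat.div_mul_cancel hdvd
    refine Subgroup.eq_of_le_of_card_ge (Subgroup.zpowers_le.2 ?_) ?_
    · obtain ⟨j, hj⟩ := Subgroup.mem_zpowers_iff.1 (hγ x)
      have hx : γ ^ (j * (orderOf x : ℤ)) = 1 := by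
        rw [zpow_mul, zpow_natCast, hj, pow_orderOf_eq_one]
      have hN := orderOf_dvd_iff_zpow_eq_one.2 hx
      rw [hord, ← hmul, Nat.cast_mul] at hN
      obtain ⟨i, rfl⟩ := Int.dvd_of_mul_dvd_mul_right
        (Nat.cast_ne_zero.2 (orderOf_pos x).ne') hN
      rw [zpow_mul, zpow_natCast] at hj
      exact ⟨i, hj⟩
    · rw [Nat.card_zpowers, Nat.card_zpowers, ← hord,
        orderOf_pow_orderOf_div (orderOf_pos γ).ne' (hord.symm ▸ hdvd)]
  rw [key g, key h, hgh]

section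

variable {F K : Type*} [Field F] [Field K] [Algebra F K]

/-- The endomorphism `w ↦ w / σ w` of the multiplicative group of `K`. -/
def divGalois (σ : K ≃ₐ[F] K) : Kˣ →* Kˣ :=
  MonoidHom.id Kˣ / (galAct F K σ).toMonoidHom

theorem divGalois_apply (σ : K ≃ₐ[F] K) (w : Kˣ) :
    divGalois σ w = w / galAct F K σ w := rfl

theorem card_ker_divGalois [Finite K] (σ : K ≃ₐ[F] K) :
    Nat.card (divGalois σ).ker =
      Nat.card (IntermediateField.fixedField (Subgroup.zpowers σ)) - 1 := by
  have hmem : ∀ x : K, x ∈ IntermediateField.fixedField (Subgroup.zpowers σ) ↔ σ x = x := by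
    intro x
    rw [IntermediateField.mem_fixedField_iff]
    refine ⟨fun h => h σ (Subgroup.mem_zpowers σ), fun h τ hτ => ?_⟩
    have hle : Subgroup.zpowers σ ≤ MulAction.stabilizer (K ≃ₐ[F] K) x := by
      rw [Subgroup.zpowers_le]
      exact h
    exact hle hτ
  have hker : ∀ w : Kˣ, w ∈ (divGalois σ).ker ↔ σ w = w := by
    intro w
    rw [MonoidHom.mem_ker, divGalois_apply, div_eq_one, eq_comm, Units.ext_iff]
    rfl
  rw [← Nat.card_units]
  refine Nat.card_congr (Equiv.ofBijective
    (fun w => Units.mk0 (⟨(w : Kˣ), (hmem _).2 ((hker _).1 w.2)⟩ :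
      IntermediateField.fixedField (Subgroup.zpowers σ)) ?_) ⟨?_, ?_⟩)
  · intro h
    exact (w : Kˣ).ne_zero (congrArg Subtype.val h)
  · intro w w' h
    exact Subtype.ext (Units.ext (congrArg Subtype.val (congrArg Units.val h)))
  · intro u
    have hu : ((u : IntermediateField.fixedField (Subgroup.zpowers σ)) : K) ≠ 0 := by
      intro h
      exact u.ne_zero (Subtype.ext h)
    refine ⟨⟨Units.mk0 _ hu, (hker _).2 ((hmem _).1 u.1.2)⟩, ?_⟩
    ext
    rfl

theorem card_range_divGalois [Finite K] (σ : K ≃ₐ[F] K) :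
    ∃ Q : ℕ, Nat.card (divGalois σ).range = ∑ i ∈ Finset.range (orderOf σ), Q ^ i := by
  set L := IntermediateField.fixedField (Subgroup.zpowers σ) with hL
  have hQ : 1 < Nat.card L := Finite.one_lt_card
  have hcard : Nat.card K = Nat.card L ^ orderOf σ := by
    rw [Module.natCard_eq_pow_finrank (K := L), hL,
      IntermediateField.finrank_fixedField_eq_card, Nat.card_zpowers]
  refine ⟨Nat.card L, ?_⟩
  have h := (divGalois σ).ker.index_mul_card
  rw [Subgroup.index_ker, card_ker_divGalois, Nat.card_units, hcard] at h
  refine Nat.eq_of_mul_eq_mul_right (Nat.sub_pos_of_lt hQ) (h.trans ?_)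
  exact (geom_sum_mul_of_one_le hQ.le _).symm

/-- The prime divisors of the index of the preimage of a subgroup under `w ↦ w / σ w`
are at least the order of `σ`, if that order is prime. -/
theorem orderOf_le_of_prime_dvd_index [Finite K] {σ : K ≃ₐ[F] K} (hσ : (orderOf σ).Prime)
    (B : Subgroup Kˣ) {t : ℕ} (ht : t.Prime) (h : t ∣ (B.comap (divGalois σ)).index) :
    orderOf σ ≤ t := by
  obtain ⟨Q, hQ⟩ := card_range_divGalois σ
  rw [Subgroup.index_comap] at h
  exact prime_le_of_dvd_geom_sum hσ ht (hQ ▸ h.trans (Subgroup.relIndex_dvd_card _ _))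

theorem eq_one_of_fixes_of_right_eq_one {act : (Kˣ ⋊[galAct F K] (K ≃ₐ[F] K)) →* Equiv.Perm K}
    (hact : ∀ g x, act g x = (g.left : K) * g.right x) {g : Kˣ ⋊[galAct F K] (K ≃ₐ[F] K)}
    {x : Kˣ} (hg : act g x = x) (hr : g.right = 1) : g = 1 := by
  refine SemidirectProduct.ext (Units.ext ?_) hr
  rw [hact, hr] at hg
  exact mul_right_cancel₀ x.ne_zero (hg.trans (one_mul _).symm)

theorem orderOf_right_of_fixes {act : (Kˣ ⋊[galAct F K] (K ≃ₐ[F] K)) →* Equiv.Perm K}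
    (hact : ∀ g x, act g x = (g.left : K) * g.right x) {g : Kˣ ⋊[galAct F K] (K ≃ₐ[F] K)}
    {x : Kˣ} (hg : act g x = x) : orderOf g.right = orderOf g := by
  rw [orderOf_eq_orderOf_iff]
  have hright : ∀ n : ℕ, (g ^ n).right = g.right ^ n := fun n => map_pow rightHom g n
  have hfix : ∀ n : ℕ, act (g ^ n) x = x := by
    intro n
    exact pow_mem (show g ∈ (MulAction.stabilizer (Equiv.Perm K) (x : K)).comap act from hg) n
  refine fun n => ⟨fun h => ?_, fun h => ?_⟩
  · exact eq_one_of_fixes_of_right_eq_one hact (hfix n) ((hright n).trans h)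
  · rw [← hright, h, one_right]

theorem fixes_iff_divGalois_right_eq_left {act : (Kˣ ⋊[galAct F K] (K ≃ₐ[F] K)) →* Equiv.Perm K}
    (hact : ∀ g x, act g x = (g.left : K) * g.right x) {g : Kˣ ⋊[galAct F K] (K ≃ₐ[F] K)}
    {x : Kˣ} : act g x = x ↔ divGalois g.right x = g.left := by
  rw [divGalois_apply, div_eq_iff_eq_mul, hact, eq_comm, Units.ext_iff]
  rfl

/-- If `g` and `h` are elements of `A` of the same order which fix `x` and `y`
respectively, then `y / x` lies in the preimage of `A ∩ Γ₀(V)` under `w ↦ w / σ w`, where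
`σ` is the Galois component of `g`. -/
theorem div_mem_comap_divGalois [Finite K]
    {act : (Kˣ ⋊[galAct F K] (K ≃ₐ[F] K)) →* Equiv.Perm K}
    (hact : ∀ g x, act g x = (g.left : K) * g.right x)
    {A : Subgroup (Kˣ ⋊[galAct F K] (K ≃ₐ[F] K))} {g h : Kˣ ⋊[galAct F K] (K ≃ₐ[F] K)}
    (hgA : g ∈ A) (hhA : h ∈ A) {x y : Kˣ} (hg : act g x = x) (hh : act h y = y)
    (hgh : orderOf g = orderOf h) :
    y / x ∈ (A.comap inl).comap (divGalois g.right) := by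
  have hmem : g.right ∈ Subgroup.zpowers h.right := by
    rw [← zpowers_eq_of_orderOf_eq ((orderOf_right_of_fixes hact hg).trans
      (hgh.trans (orderOf_right_of_fixes hact hh).symm))]
    exact Subgroup.mem_zpowers _
  obtain ⟨j, hj⟩ := hmem
  have hjright : (h ^ j).right = g.right := (map_zpow rightHom h j).trans hj
  have hjfix : act (h ^ j) y = y :=
    zpow_mem (show h ∈ (MulAction.stabilizer (Equiv.Perm K) (y : K)).comap act from hh) j
  rw [Subgroup.mem_comap, map_div, (fixes_iff_divGalois_right_eq_left hact).1 hg, ← hjright,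
    (fixes_iff_divGalois_right_eq_left hact).1 hjfix, Subgroup.mem_comap]
  have : inl ((h ^ j).left / g.left) = h ^ j * g⁻¹ := by
    rw [eq_mul_inv_iff_mul_eq]
    exact SemidirectProduct.ext (by simp [-map_div]) (by simp [hjright, -map_div])
  rw [this]
  exact A.mul_mem (A.zpow_mem hhA j) (A.inv_mem hgA)

/-- Conversely, multiplying a fixed point of `g` by an element of that preimage gives a
fixed point of another element of `A` of the same order. -/
theorem exists_fixes_mul_of_mem_comap_divGalois
    {act : (Kˣ ⋊[galAct F K] (K ≃ₐ[F] K)) →* Equiv.Perm K}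
    (hact : ∀ g x, act g x = (g.left : K) * g.right x)
    {A : Subgroup (Kˣ ⋊[galAct F K] (K ≃ₐ[F] K))} {g : Kˣ ⋊[galAct F K] (K ≃ₐ[F] K)}
    (hgA : g ∈ A) {x w : Kˣ} (hg : act g x = x)
    (hw : w ∈ (A.comap inl).comap (divGalois g.right)) :
    ∃ h ∈ A, orderOf h = orderOf g ∧ act h (w * x : Kˣ) = (w * x : Kˣ) := by
  have hfix : act (inl (divGalois g.right w) * g) (w * x : Kˣ) = (w * x : Kˣ) := by
    rw [fixes_iff_divGalois_right_eq_left hact]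
    simp [(fixes_iff_divGalois_right_eq_left hact).1 hg]
  refine ⟨_, A.mul_mem hw hgA, ?_, hfix⟩
  rw [← orderOf_right_of_fixes hact hfix, ← orderOf_right_of_fixes hact hg]
  simp

/-- If some unit is not fixed by any element of `A` of prime order `r`, then the exponents
of the powers of a generator `γ` which are fixed by such elements lie in a single residue
class modulo some prime `t ≥ r`. -/
theorem exists_modEq_of_not_fixed [Finite K]
    {act : (Kˣ ⋊[galAct F K] (K ≃ₐ[F] K)) →* Equiv.Perm K}
    (hact : ∀ g x, act g x = (g.left : K) * g.right x)
    (A : Subgroup (Kˣ ⋊[galAct F K] (K ≃ₐ[F] K))) {r : ℕ} (hr : r.Prime) {γ : Kˣ}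
    (hγ : ∀ x, x ∈ Subgroup.zpowers γ) {y : Kˣ}
    (hy : ∀ g ∈ A, orderOf g = r → act g y ≠ y) :
    ∃ t c : ℕ, t.Prime ∧ r ≤ t ∧ ∀ k : ℕ, ∀ g ∈ A, orderOf g = r →
      act g (γ ^ k : Kˣ) = (γ ^ k : Kˣ) → k ≡ c [MOD t] := by
  by_cases hex : ∃ c : ℕ, ∃ g ∈ A, orderOf g = r ∧ act g (γ ^ c : Kˣ) = (γ ^ c : Kˣ)
  · obtain ⟨c, g, hgA, hgr, hg⟩ := hex
    set W := (A.comap inl).comap (divGalois g.right)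
    have hne : W.index ≠ 1 := by
      intro h1
      obtain ⟨h, hhA, hhr, hh⟩ := exists_fixes_mul_of_mem_comap_divGalois hact hgA hg
        (show y / γ ^ c ∈ W by rw [Subgroup.index_eq_one.1 h1]; trivial)
      rw [div_mul_cancel] at hh
      exact hy h hhA (hhr.trans hgr) hh
    obtain ⟨t, ht, htW⟩ := Nat.exists_prime_and_dvd hne
    have hor : orderOf g.right = r := (orderOf_right_of_fixes hact hg).trans hgr
    refine ⟨t, c, ht, hor ▸ orderOf_le_of_prime_dvd_index (hor ▸ hr) _ ht htW, ?_⟩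
    intro k h hhA hhr hh
    have hmem := div_mem_comap_divGalois hact hgA hhA hg hh (hgr.trans hhr.symm)
    rw [← zpow_natCast, ← zpow_natCast, div_eq_mul_inv, ← zpow_sub] at hmem
    exact (Nat.modEq_iff_dvd.2
      ((Int.natCast_dvd_natCast.2 htW).trans (index_dvd_of_zpow_mem hγ W hmem))).symm
  · exact ⟨r, 0, hr, le_rfl, fun k g hgA hgr hg => (hex ⟨k, g, hgA, hgr, hg⟩).elim⟩

end

/-- Let `V = GF(q^n)`, viewed as an `n`-dimensional `GF(q)`-vector space,
and let `A ≤ Γ(V)`, `B = A ∩ Γ₀(V)`, and `π` the set of primes `r` such that `A \ B` has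
an element of order `r`.  If `A` has no regular orbit on `V`, then there is a prime
`s ∈ π` such that every `v ∈ V` is fixed by some element of `A` of order `s`.

`Γ(V)` is modelled by the group `Kˣ ⋊[galAct F K] (K ≃ₐ[F] K)` together with its natural
action `act` on `V = K` given by `act (a, σ) x = a * σ(x)`; `Γ₀(V)` corresponds to the
range of `inl`. -/
theorem stmt_8 (F K : Type*) [Field F] [Field K] [Fintype F] [Fintype K] [Algebra F K]
    (q n : ℕ) (hq : Fintype.card F = q) (hK : Fintype.card K = q ^ n)
    (act : (Kˣ ⋊[galAct F K] (K ≃ₐ[F] K)) →* Equiv.Perm K)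
    (hact : ∀ (g : Kˣ ⋊[galAct F K] (K ≃ₐ[F] K)) (x : K),
      act g x = (g.left : K) * g.right x)
    (A : Subgroup (Kˣ ⋊[galAct F K] (K ≃ₐ[F] K)))
    (hnoreg : ¬ ∃ v : K, ∀ g ∈ A, act g v = v → g = 1) :
    ∃ s : ℕ, s.Prime ∧
      (∃ x ∈ A, x ∉ (inl : Kˣ →* Kˣ ⋊[galAct F K] (K ≃ₐ[F] K)).range ∧ orderOf x = s) ∧
      ∀ v : K, ∃ g ∈ A, orderOf g = s ∧ act g v = v := by
  have : Finite (Kˣ ⋊[galAct F K] (K ≃ₐ[F] K)) :=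
    Finite.of_equiv _ SemidirectProduct.equivProd.symm
  by_contra hcon
  have hnot : ∀ s : ℕ, s.Prime → ∃ y : Kˣ, ∀ g ∈ A, orderOf g = s → act g y ≠ y := by
    intro s hs
    by_contra! hfix
    obtain ⟨g, hgA, hgs, hg⟩ := hfix 1
    refine hcon ⟨s, hs, ⟨g, hgA, ?_, hgs⟩, fun v => ?_⟩
    · rintro ⟨a, rfl⟩
      rw [eq_one_of_fixes_of_right_eq_one hact hg (right_inl a), orderOf_one] at hgs
      exact hs.ne_one hgs.symm
    · by_cases hv : v = 0
      · exact ⟨g, hgA, hgs, by simp [hv, hact]⟩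
      · exact hfix (Units.mk0 v hv)
  obtain ⟨γ, hγ⟩ := IsCyclic.exists_generator (α := Kˣ)
  have hres := fun (s : ℕ) (hs : s.Prime) =>
    (hnot s hs).elim fun y hy => exists_modEq_of_not_fixed hact A hs hγ hy
  choose! t c ht hrt hmod using hres
  have hP : ∀ s ∈ (Nat.card A).primeFactors, s.Prime := fun s => Nat.prime_of_mem_primeFactors
  obtain ⟨k, hk⟩ := exists_forall_not_modEq (Nat.card A).primeFactors t c
    (fun s hs => (hP s hs).two_le) (fun s hs => ht s (hP s hs)) (fun s hs => hrt s (hP s hs))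
  refine hnoreg ⟨(γ ^ k : Kˣ), fun g hgA hg => ?_⟩
  by_contra hg1
  obtain ⟨s, hs, hsg⟩ := Nat.exists_prime_and_dvd (mt orderOf_eq_one_iff.1 hg1)
  have hsA : s ∣ Nat.card A := hsg.trans (A.orderOf_dvd_natCard hgA)
  refine hk s (Nat.mem_primeFactors.2 ⟨hs, hsA, Nat.card_pos.ne'⟩)
    (hmod s hs k (g ^ (orderOf g / s)) (A.pow_mem hgA _)
      (orderOf_pow_orderOf_div (orderOf_pos g).ne' hsg) ?_)
  exact pow_mem (show g ∈ (MulAction.stabilizer (Equiv.Perm K) ((γ ^ k : Kˣ) : K)).comap act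
    from hg) _
end

section
/- Let S be a solvable group acting faithfully and transitively on a finite set Ω with |S| odd. Then S has a regular orbit on the power set P(Ω); that is, there exists a subset Δ ⊆ Ω whose setwise stabilizer in S is trivial. -/
open Pointwise

section Affine

open Function

variable {V : Type*} [AddCommGroup V]

/-- An affine self-map of an abelian group some odd iterate of which is the identity. -/
structure IsOddAffine (g : V → V) : Prop where
  affine : ∀ x y z, g (x - y + z) = g x - g y + g z
  periodic : ∃ k, Odd k ∧ ∀ x, IsPeriodicPt g k x

namespace IsOddAffine

variable {g : V → V}

theorem injective (hg : IsOddAffine g) : Injective g := by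
  obtain ⟨k, hk, h⟩ := hg.periodic
  obtain ⟨j, rfl⟩ := hk
  intro x y hxy
  rw [← (h x).eq, ← (h y).eq, iterate_add_apply, iterate_add_apply, iterate_one, hxy]

theorem fixed_of_iterate (hg : IsOddAffine g) (m : ℕ) {x : V} (h : g^[2 ^ m] x = x) :
    g x = x := by
  obtain ⟨k, hk, hp⟩ := hg.periodic
  have := (show IsPeriodicPt g (2 ^ m) x from h).gcd (hp x)
  rwa [(Nat.Coprime.pow_left m (Nat.coprime_two_left.2 hk)).gcd_eq_one] at this

theorem fixed_of_sup_eq_top (hg : IsOddAffine g) {W : AddSubgroup V} {q : V}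
    (hW : ∀ x ∈ W, g x = x) (hq : g q = q) (htop : W ⊔ AddSubgroup.zmultiples q = ⊤) (x : V) :
    g x = x := by
  have h0 : g 0 = 0 := hW 0 W.zero_mem
  let E : AddSubgroup V :=
    { carrier := {x | g x = x}
      zero_mem' := h0
      add_mem' := by
        intro a b ha hb
        have := hg.affine a 0 b
        simp_all
      neg_mem' := by
        intro a ha
        have := hg.affine 0 a 0
        simp_all }
  have hE : W ⊔ AddSubgroup.zmultiples q ≤ E :=
    sup_le hW (AddSubgroup.zmultiples_le_of_mem hq)
  rw [htop] at hE
  exact hE (AddSubgroup.mem_top x)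

theorem restrict (hg : IsOddAffine g) {W : AddSubgroup V} (hW : ∀ x ∈ W, g x ∈ W) :
    IsOddAffine (fun x : W => (⟨g x, hW x x.2⟩ : W)) := by
  refine ⟨fun x y z => Subtype.ext (by simpa using hg.affine x y z), ?_⟩
  obtain ⟨k, hk, hp⟩ := hg.periodic
  refine ⟨k, hk, fun x => Subtype.ext ?_⟩
  have : Semiconj (Subtype.val : W → V) (fun x : W => (⟨g x, hW x x.2⟩ : W)) g := fun _ => rfl
  exact (this.iterate_right k x).trans (hp x)

/-- An odd affine map that maps more than a third of a subgroup of odd order into itself maps all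
of it into itself. -/
theorem mapsTo_of_card_lt [Finite V] (hg : IsOddAffine g) {W : AddSubgroup V}
    (hodd : Odd (Nat.card W))
    (h : Nat.card W < 3 * {x : W | g x ∈ W}.ncard) : ∀ x ∈ W, g x ∈ W := by
  have hne : {x : W | g x ∈ W}.Nonempty := by
    rw [← Set.ncard_pos]; omega
  obtain ⟨t, ht⟩ := hne
  rw [Set.mem_ofPred_eq] at ht
  let H : AddSubgroup W :=
    { carrier := {x | g (x + t) ∈ W}
      zero_mem' := by simpa using ht
      add_mem' := by
        intro a b ha hb
        have := hg.affine (a + t) t (b + t)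
        rw [show (a + t - t + (b + t) : V) = ((a + b : W) : V) + t by push_cast; abel] at this
        rw [Set.mem_ofPred_eq, this]
        exact W.add_mem (W.sub_mem ha ht) hb
      neg_mem' := by
        intro a ha
        have := hg.affine t (a + t) t
        rw [show (t - (a + t) + t : V) = ((-a : W) : V) + t by push_cast; abel] at this
        rw [Set.mem_ofPred_eq, this]
        exact W.add_mem (W.sub_mem ht ha) ht }
  have hH : Nat.card H = {x : W | g x ∈ W}.ncard := by
    rw [show {x : W | g x ∈ W} = (fun x => x + t) '' (H : Set W) by
      ext x
      simp only [Set.mem_ofPred_eq, Set.mem_image]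
      constructor
      · intro hx
        exact ⟨x - t, by change g (((x - t : W) : V) + t) ∈ W; simpa using hx, by simp⟩
      · rintro ⟨y, hy, rfl⟩
        exact hy, Set.ncard_image_of_injective _ (add_left_injective t)]
    rfl
  obtain ⟨m, hm⟩ := H.card_addSubgroup_dvd_card
  have hmodd : Odd m := by rw [hm] at hodd; exact (Nat.odd_mul.1 hodd).2
  have hm1 : m = 1 := by
    obtain ⟨j, rfl⟩ := hmodd
    rcases j with _ | j
    · rfl
    · rw [← hH] at h; nlinarith
  have hHtop : H = ⊤ := AddSubgroup.eq_top_of_card_eq H (by rw [hm, hm1, mul_one])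
  intro x hx
  have : (⟨x, hx⟩ - t : W) ∈ H := hHtop ▸ AddSubgroup.mem_top _
  change g (((⟨x, hx⟩ - t : W) : V) + t) ∈ W at this
  simpa using this

end IsOddAffine

/-- A subset of an abelian group that is not preserved by any nontrivial odd affine map. -/
def IsAffineRigid (D : Set V) : Prop :=
  ∀ g : V → V, IsOddAffine g → (∀ x, g x ∈ D ↔ x ∈ D) → ∀ x, g x = x

theorem IsAffineRigid.compl {D : Set V} (h : IsAffineRigid D) : IsAffineRigid Dᶜ :=
  fun g hg hD => h g hg fun x => not_iff_not.1 (hD x)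

theorem isAffineRigid_pair {q : V} (htop : AddSubgroup.zmultiples q = ⊤) :
    IsAffineRigid ({0, q} : Set V) := by
  intro g hg hD
  have h0 : g 0 = 0 ∨ g 0 = q := by simpa using hD 0
  have hq : g q = 0 ∨ g q = q := by simpa using hD q
  have hi := hg.injective
  have h0' : g 0 = 0 := by
    apply hg.fixed_of_iterate 1
    simp only [pow_one, iterate_succ, iterate_zero, comp_apply, id]
    rcases h0 with h | h
    · rw [h, h]
    · rcases hq with h' | h'
      · rw [h, h']
      · rw [h, h', ← hi (h.trans h'.symm)]
  have hq' : g q = q := by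
    rcases hq with h | h
    · rw [h, ← hi (h.trans h0'.symm)]
    · exact h
  refine hg.fixed_of_sup_eq_top (W := ⊥) (q := q) ?_ hq' (by simpa using htop)
  simpa using h0'

theorem isAffineRigid_signed_pair [Finite V] (hodd : Odd (Nat.card V)) {u q : V} (hu : u ≠ 0)
    (hq : q ∉ AddSubgroup.zmultiples u)
    (htop : AddSubgroup.zmultiples u ⊔ AddSubgroup.zmultiples q = ⊤) :
    IsAffineRigid ({u, -u, q, -q} : Set V) := by
  classical
  intro g hg hD
  have two {x : V} (hx : x + x = 0) : x = 0 := by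
    have h2 : addOrderOf x ∣ 2 := addOrderOf_dvd_of_nsmul_eq_zero (by rw [two_nsmul, hx])
    have hc := addOrderOf_dvd_natCard x
    have := Nat.dvd_gcd h2 hc
    rw [(Nat.coprime_two_left.2 hodd).gcd_eq_one] at this
    exact AddMonoid.addOrderOf_eq_one_iff.1 (Nat.dvd_one.1 this)
  have hi := hg.injective
  have hq0 : q ≠ 0 := fun h => hq (h ▸ zero_mem _)
  have huq : u ≠ q := fun h => hq (h ▸ AddSubgroup.mem_zmultiples u)
  have hunq : u ≠ -q := fun h => hq (by
    rw [← neg_neg q, ← h]; exact neg_mem (AddSubgroup.mem_zmultiples u))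
  have huu : u ≠ -u := fun h => hu (two (by nth_rw 2 [h]; simp))
  have hqq : q ≠ -q := fun h => hq0 (two (by nth_rw 2 [h]; simp))
  have hneg (x : V) : g (-x) = g 0 - g x + g 0 := by simpa using hg.affine 0 x 0
  have hsum : ∑ x ∈ ({u, -u, q, -q} : Finset V), g x = ∑ x ∈ ({u, -u, q, -q} : Finset V), x := by
    exact Finset.sum_equiv (Equiv.ofBijective g (Finite.injective_iff_bijective.1 hi))
      (fun x => by simpa using (hD x).symm) (fun _ _ => rfl)
  have h0 : g 0 = 0 := by
    rw [Finset.sum_insert, Finset.sum_insert, Finset.sum_pair hqq, Finset.sum_insert,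
      Finset.sum_insert, Finset.sum_pair hqq, hneg, hneg] at hsum
    · refine two (two ?_)
      refine Eq.trans ?_ (sub_eq_zero.2 hsum)
      abel
    all_goals simp [huq, hunq, huu, neg_eq_iff_eq_neg]
  have hn (x : V) : g (-x) = - g x := by rw [hneg, h0]; simp
  have hu' : g u = u ∨ g u = -u ∨ g u = q ∨ g u = -q := by simpa using hD u
  have hq' : g q = u ∨ g q = -u ∨ g q = q ∨ g q = -q := by simpa using hD q
  have hnu : ¬ g u = g q := fun h => huq (hi h)
  have hnu' : ¬ g u = - g q := fun h => hunq (hi (h.trans (hn q).symm))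
  have key : g^[2 ^ 2] u = u ∧ g^[2 ^ 2] q = q := by
    simp only [show 2 ^ 2 = 4 from rfl, iterate_succ, iterate_zero, comp_apply, id]
    rcases hu' with h | h | h | h <;> rcases hq' with h' | h' | h' | h' <;>
      first
      | exact absurd (h.trans h'.symm) hnu
      | (refine absurd ?_ hnu'; simp [h, h']; done)
      | simp [h, h', hn]
  refine hg.fixed_of_sup_eq_top (W := AddSubgroup.zmultiples u) ?_
    (hg.fixed_of_iterate 2 key.2) htop
  have hgu := hg.fixed_of_iterate 2 key.1
  have : AddSubgroup.zmultiples u ≤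
      { carrier := {x | g x = x}
        zero_mem' := h0
        add_mem' := by
          intro a b ha hb
          have := hg.affine a 0 b
          simp_all
        neg_mem' := by
          intro a ha
          rw [Set.mem_ofPred_eq, hn, ha] : AddSubgroup V } :=
    AddSubgroup.zmultiples_le_of_mem hgu
  exact this

theorem IsAffineRigid.insert_image [Finite V] {W : AddSubgroup V} {D : Set W}
    (hD : IsAffineRigid D) (hodd : Odd (Nat.card W)) (hcard : 3 < Nat.card W)
    (hlarge : Nat.card W < 2 * D.ncard) {q : V} (hq : q ∉ W)
    (htop : W ⊔ AddSubgroup.zmultiples q = ⊤) :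
    IsAffineRigid (insert q (Subtype.val '' D)) := by
  intro g hg hpres
  have hi := hg.injective
  have hDg (x : W) (hx : x ∈ D) : g x = q ∨ ∃ y ∈ D, (y : V) = g x :=
    (hpres x).2 (Or.inr ⟨x, hx, rfl⟩)
  have hsub : D ⊆ {x : W | g x ∈ W} ∪ {x : W | g x = q} := by
    intro x hx
    rcases hDg x hx with h | ⟨y, -, hy⟩
    · exact Or.inr h
    · exact Or.inl (by rw [Set.mem_ofPred_eq, ← hy]; exact y.2)
  have hone : {x : W | g x = q}.ncard ≤ 1 :=
    (Set.ncard_le_one (Set.toFinite _)).2 fun a ha b hb => Subtype.ext (hi (ha.trans hb.symm))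
  have hle := (Set.ncard_le_ncard hsub).trans (Set.ncard_union_le _ _)
  have hW : ∀ x ∈ W, g x ∈ W := by
    apply hg.mapsTo_of_card_lt hodd
    obtain ⟨j, hj⟩ := hodd
    omega
  have hgq : g q = q := by
    rcases (hpres q).2 (Or.inl rfl) with h | ⟨y, -, hy⟩
    · exact h
    · have hsurj := Finite.surjective_of_injective (hg.restrict hW).injective
      obtain ⟨z, hz⟩ := hsurj y
      have : g z = g q := by rw [← hy, ← hz]
      exact absurd (hi this ▸ z.2) hq
  refine hg.fixed_of_sup_eq_top (fun x hx => ?_) hgq htop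
  refine congrArg Subtype.val (hD _ (hg.restrict hW) (fun y => ?_) ⟨x, hx⟩)
  have hmem (z : W) : (z : V) ∈ insert q (Subtype.val '' D) ↔ z ∈ D := by
    constructor
    · rintro (h | ⟨y, hy, h⟩)
      · exact absurd (h ▸ z.2) hq
      · exact Subtype.ext h ▸ hy
    · exact fun h => Or.inr ⟨z, h, rfl⟩
  rw [← hmem, ← hmem]
  exact hpres y

theorem exists_isAffineRigid (V : Type*) [AddCommGroup V] [Finite V] (hodd : Odd (Nat.card V)) :
    ∃ D : Set V, IsAffineRigid D := by
  induction hn : Nat.card V using Nat.strong_induction_on generalizing V with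
  | _ n ih =>
  subst hn
  rcases subsingleton_or_nontrivial V with hV | hV
  · exact ⟨∅, fun g _ _ x => Subsingleton.elim _ _⟩
  obtain ⟨W, hW, -⟩ := (eq_top_or_exists_le_coatom (⊥ : AddSubgroup V)).resolve_left bot_ne_top
  obtain ⟨q, -, hq⟩ := SetLike.exists_of_lt hW.lt_top
  have htop : W ⊔ AddSubgroup.zmultiples q = ⊤ :=
    hW.2 _ (lt_of_le_of_ne le_sup_left fun h =>
      hq (h ▸ (le_sup_right : _ ≤ W ⊔ AddSubgroup.zmultiples q) (AddSubgroup.mem_zmultiples q)))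
  have hWodd : Odd (Nat.card W) := hodd.of_dvd_nat W.card_addSubgroup_dvd_card
  have hlt : Nat.card W < Nat.card V :=
    lt_of_le_of_ne W.card_le_card_addGroup fun h => hW.1 (AddSubgroup.eq_top_of_card_eq W h)
  rcases lt_trichotomy (Nat.card W) 3 with h | h | h
  · have : Nat.card W = 1 := by
      obtain ⟨j, hj⟩ := hWodd
      omega
    rw [AddSubgroup.eq_bot_of_card_eq W this, bot_sup_eq] at htop
    exact ⟨_, isAffineRigid_pair htop⟩
  · have : Nontrivial W := Finite.one_lt_card_iff_nontrivial.1 (by omega)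
    obtain ⟨u, hu⟩ := exists_ne (0 : W)
    have hzu : AddSubgroup.zmultiples (u : V) = W := by
      have : Fact (Nat.Prime 3) := ⟨Nat.prime_three⟩
      refine le_antisymm (AddSubgroup.zmultiples_le_of_mem u.2) fun x hx => ?_
      have hmem : (⟨x, hx⟩ : W) ∈ AddSubgroup.zmultiples u :=
        zmultiples_eq_top_of_prime_card h hu ▸ AddSubgroup.mem_top _
      obtain ⟨k, hk⟩ := hmem
      exact ⟨k, congrArg Subtype.val hk⟩
    rw [← hzu] at hq htop
    exact ⟨_, isAffineRigid_signed_pair hodd (by simpa using hu) hq htop⟩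
  · obtain ⟨D, hD⟩ := ih _ hlt W hWodd rfl
    have hc := Set.ncard_add_ncard_compl D
    by_cases hl : Nat.card W < 2 * D.ncard
    · exact ⟨_, hD.insert_image hWodd h hl hq htop⟩
    · refine ⟨_, hD.compl.insert_image hWodd h ?_ hq htop⟩
      obtain ⟨j, hj⟩ := hWodd
      omega

end Affine

section Actions

open MulAction

universe u

/-- A set all of whose setwise stabilizing elements act trivially. -/
def HasRegularSubset (S Ω : Type*) [Group S] [MulAction S Ω] : Prop :=
  ∃ Δ : Set Ω, ∀ s : S, (∀ x, s • x ∈ Δ ↔ x ∈ Δ) → ∀ x : Ω, s • x = x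

variable {S Ω : Type*} [Group S] [MulAction S Ω]

theorem hasRegularSubset_of_range (h : HasRegularSubset (toPermHom S Ω).range Ω) :
    HasRegularSubset S Ω := by
  obtain ⟨Δ, hΔ⟩ := h
  exact ⟨Δ, fun s hs => hΔ ⟨toPermHom S Ω s, s, rfl⟩ hs⟩

theorem isPretransitive_toPermHom_range [IsPretransitive S Ω] :
    IsPretransitive (toPermHom S Ω).range Ω := by
  refine ⟨fun x y => ?_⟩
  obtain ⟨s, hs⟩ := exists_smul_eq S x y
  exact ⟨⟨_, s, rfl⟩, hs⟩

theorem smul_eq_self_of_sq_smul (hodd : Odd (Nat.card S)) {s : S} {x : Ω}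
    (h : s • s • x = x) : s • x = x := by
  have h2 : s ^ 2 ∈ stabilizer S x := by
    rw [mem_stabilizer_iff, pow_two, mul_smul, h]
  obtain ⟨j, hj⟩ := hodd
  have hk : s * (s ^ 2) ^ j = 1 := by
    rw [← pow_mul, ← pow_succ', ← hj, pow_card_eq_one']
  have := mem_stabilizer_iff.1 (pow_mem h2 j)
  calc s • x = s • (s ^ 2) ^ j • x := by rw [this]
    _ = x := by rw [← mul_smul, hk, one_smul]

/-- If a commutative normal subgroup `V` is transitive, then it is regular, and the whole group
acts on `Ω ≃ V` by odd affine maps. -/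
theorem hasRegularSubset_of_pretransitive [FaithfulSMul S Ω] [Finite S]
    (hodd : Odd (Nat.card S)) (V : Subgroup S) [V.Normal] [IsMulCommutative V]
    [IsPretransitive V Ω] : HasRegularSubset S Ω := by
  let _ : CommGroup V := { mul_comm := mul_comm' }
  rcases isEmpty_or_nonempty Ω with hΩ | ⟨⟨ω⟩⟩
  · exact ⟨∅, fun s _ x => isEmptyElim x⟩
  have hVodd : Odd (Nat.card V) := hodd.of_dvd_nat V.card_subgroup_dvd_card
  let φ : Additive V → Ω := fun v => v.toMul • ω
  have hφ : Function.Bijective φ := by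
    refine ⟨fun v w hvw => ?_, fun x => exists_smul_eq V ω x⟩
    apply Additive.toMul.injective
    refine FaithfulSMul.eq_of_smul_eq_smul (α := Ω) fun x => ?_
    obtain ⟨u, rfl⟩ := exists_smul_eq V ω x
    rw [← mul_smul, ← mul_smul, mul_comm, mul_comm _ u, mul_smul, mul_smul]
    exact congrArg (u • ·) hvw
  let e := Equiv.ofBijective φ hφ
  obtain ⟨D, hD⟩ := exists_isAffineRigid (Additive V) hVodd
  refine ⟨e '' D, fun s hs => ?_⟩
  let g : Additive V → Additive V := fun v => e.symm (s • e v)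
  have heg (v) : e (g v) = s • e v := e.apply_symm_apply _
  have he (v : Additive V) : e v = v.toMul • ω := rfl
  have hg : IsOddAffine g := by
    refine ⟨fun x y z => e.injective ?_, Nat.card S, hodd, fun x => e.injective ?_⟩
    · obtain ⟨c, hc⟩ := exists_smul_eq V ω (s • ω)
      have hgc (v : Additive V) : g v = Additive.ofMul (MulAut.conjNormal s v.toMul * c) := by
        apply e.injective
        rw [heg, he, he, toMul_ofMul, mul_smul, hc, Subgroup.smul_def, Subgroup.smul_def,
          MulAut.conjNormal_apply, ← mul_smul, ← mul_smul]
        congr 1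
        group
      congr 1
      rw [hgc, hgc, hgc, hgc, ← ofMul_div, ← ofMul_mul]
      simp only [toMul_add, toMul_sub, map_mul, map_div]
      congr 1
      rw [mul_div_mul_right_eq_div, mul_assoc]
    · have : Function.Semiconj e g (s • ·) := heg
      rw [(this.iterate_right _).eq, smul_iterate, pow_card_eq_one']
      exact one_smul S (e x)
  intro x
  obtain ⟨v, rfl⟩ := e.surjective x
  rw [← heg, hD g hg (fun v => ?_) v]
  rw [← e.injective.mem_set_image (s := D), heg, hs, e.injective.mem_set_image]

/-- Regular subsets for the action on the blocks and for the action of a block stabilizer on its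
block combine to a regular subset. -/
theorem hasRegularSubset_of_isBlock [IsPretransitive S Ω] (hodd : Odd (Nat.card S)) {B : Set Ω}
    (hB : IsBlock S B) (hne : B.Nonempty) (h₁ : HasRegularSubset (stabilizer S B) B)
    (h₂ : HasRegularSubset S (orbit S B)) : HasRegularSubset S Ω := by
  obtain ⟨D, hD⟩ := h₁
  obtain ⟨A, hA⟩ := h₂
  have hr (b : orbit S B) : ∃ r : S, r • B = b := b.2
  choose r hr using hr
  obtain ⟨x₀, hx₀⟩ := hne
  let Δ : Set Ω := {x | ∃ b : orbit S B, ∃ y : B, x = r b • (y : Ω) ∧ (y ∈ D ↔ b ∈ A)}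
  have hΔ (b : orbit S B) (y : B) : r b • (y : Ω) ∈ Δ ↔ (y ∈ D ↔ b ∈ A) := by
    refine ⟨?_, fun h => ⟨b, y, rfl, h⟩⟩
    rintro ⟨b', y', hy, h⟩
    have hbb : b = b' := by
      apply Subtype.ext
      rw [← hr, ← hr]
      by_contra hne
      exact Set.disjoint_left.1 (hB hne) (Set.smul_mem_smul_set y.2)
        (hy ▸ Set.smul_mem_smul_set y'.2)
    subst hbb
    rwa [Subtype.ext (smul_left_cancel _ hy)]
  refine ⟨Δ, fun s hs => ?_⟩
  let t (b : orbit S B) : stabilizer S B := ⟨(r (s • b))⁻¹ * s * r b, by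
    rw [mem_stabilizer_iff, mul_smul, mul_smul, hr, inv_smul_eq_iff, hr]; rfl⟩
  have ht (b : orbit S B) (y : B) : r (s • b) • ((t b • y : B) : Ω) = s • r b • (y : Ω) := by
    rw [show ((t b • y : B) : Ω) = ((r (s • b))⁻¹ * s * r b) • (y : Ω) from rfl]
    simp [mul_smul]
  have hiff (b : orbit S B) (y : B) : (t b • y ∈ D ↔ s • b ∈ A) ↔ (y ∈ D ↔ b ∈ A) := by
    rw [← hΔ, ← hΔ, ht, hs]
  have hfix (b : orbit S B) : s • b = b := by
    refine hA s (fun b => ?_) b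
    by_contra hb
    have hsw (y : B) : t b • y ∈ D ↔ ¬ y ∈ D := by
      have := hiff b y
      tauto
    have hsq := hD (t b * t b) fun y => by rw [mul_smul, hsw, hsw, not_not]
    have := smul_eq_self_of_sq_smul (hodd.of_dvd_nat (Subgroup.card_subgroup_dvd_card _))
      ((mul_smul (t b) (t b) _).symm.trans (hsq ⟨x₀, hx₀⟩))
    have h' := hsw ⟨x₀, hx₀⟩
    rw [this] at h'
    tauto
  intro x
  obtain ⟨u, hu⟩ := exists_smul_eq S x₀ x
  let b : orbit S B := ⟨u • B, u, rfl⟩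
  have hx : x ∈ r b • B := by
    rw [hr]; exact hu ▸ Set.smul_mem_smul_set hx₀
  obtain ⟨y, hy, rfl⟩ := hx
  have h := hD (t b) (fun y => by have := hiff b y; rw [hfix] at this; tauto) ⟨y, hy⟩
  have h' := ht b ⟨y, hy⟩
  rw [h, hfix] at h'
  exact h'.symm

/-- A nontrivial solvable group has a nontrivial commutative normal subgroup. -/
theorem exists_normal_isMulCommutative_ne_bot (G : Type*) [Group G] [Group.IsSolvable G]
    [Nontrivial G] : ∃ V : Subgroup G, V.Normal ∧ IsMulCommutative V ∧ V ≠ ⊥ := by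
  classical
  have h := (Group.isSolvable_def G).1 inferInstance
  obtain ⟨m, hm⟩ : ∃ m, Nat.find h = m + 1 := Nat.exists_eq_succ_of_ne_zero fun h0 => by
    have := Nat.find_spec h
    rw [h0, derivedSeries_zero] at this
    exact top_ne_bot this
  refine ⟨derivedSeries G m, inferInstance, ?_, Nat.find_min h (by omega)⟩
  have := Nat.find_spec h
  rw [hm, derivedSeries_succ, Subgroup.commutator_eq_bot_iff_le_centralizer] at this
  exact ⟨⟨fun a b => Subtype.ext (this b.2 a a.2)⟩⟩

theorem stabilizer_isPretransitive_of_isBlock [IsPretransitive S Ω] {B : Set Ω}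
    (hB : IsBlock S B) : IsPretransitive (stabilizer S B) B := by
  refine ⟨fun x y => ?_⟩
  obtain ⟨s, hs⟩ := exists_smul_eq S (x : Ω) y
  exact ⟨⟨s, isBlock_iff_smul_eq_of_mem.1 hB x.2 (hs ▸ y.2)⟩, Subtype.ext hs⟩

theorem hasRegularSubset_of_faithfulSMul {S Ω : Type*} [Group S] [MulAction S Ω] [Finite Ω]
    [FaithfulSMul S Ω] [Group.IsSolvable S] [IsPretransitive S Ω] (hodd : Odd (Nat.card S))
    (ih : ∀ B : Set Ω, IsBlock S B → B.Nonempty → B.ncard < Nat.card Ω →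
      (orbit S B).ncard < Nat.card Ω →
      HasRegularSubset (stabilizer S B) B ∧ HasRegularSubset S (orbit S B)) :
    HasRegularSubset S Ω := by
  have : Finite S := Nat.finite_of_card_ne_zero fun h => by simp [h] at hodd
  rcases subsingleton_or_nontrivial S with hS | hS
  · exact ⟨∅, fun s _ x => by rw [Subsingleton.elim s 1, one_smul]⟩
  obtain ⟨V, hV, hVcomm, hVbot⟩ := exists_normal_isMulCommutative_ne_bot S
  by_cases htrans : IsPretransitive V Ω
  · exact hasRegularSubset_of_pretransitive hodd V
  obtain ⟨v, hv1⟩ := V.ne_bot_iff_exists_ne_one.1 hVbot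
  obtain ⟨ω, hω⟩ : ∃ ω : Ω, v • ω ≠ ω := by
    by_contra! h
    exact hv1 (FaithfulSMul.eq_of_smul_eq_smul (α := Ω) fun x => by rw [h, one_smul])
  have hB : IsBlock S (orbit V ω) := IsBlock.orbit_of_normal ω
  have hne : (orbit V ω).Nonempty := nonempty_orbit ω
  have hmul := hB.ncard_block_mul_ncard_orbit_eq hne
  have hlt : (orbit V ω).ncard < Nat.card Ω := by
    rw [← Set.ncard_univ]
    refine Set.ncard_lt_ncard (Set.ssubset_univ_iff.2 fun h => htrans ?_)
    exact (isPretransitive_iff_orbit_eq_univ ω).2 h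
  have hone : 1 < (orbit V ω).ncard :=
    (Set.one_lt_ncard).2 ⟨v • ω, mem_orbit ω v, ω, mem_orbit_self ω, hω⟩
  have hlt' : (orbit S (orbit V ω)).ncard < Nat.card Ω := by
    rw [← hmul] at hlt ⊢
    nlinarith
  obtain ⟨h₁, h₂⟩ := ih _ hB hne hlt hlt'
  exact hasRegularSubset_of_isBlock hodd hB hne h₁ h₂

theorem hasRegularSubset_of_isSolvable_of_odd {S Ω : Type u} [Group S] [MulAction S Ω] [Finite Ω]
    [Group.IsSolvable S] [IsPretransitive S Ω] (hodd : Odd (Nat.card S)) :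
    HasRegularSubset S Ω := by
  induction hn : Nat.card Ω using Nat.strong_induction_on generalizing Ω S with
  | _ n ih =>
  subst hn
  apply hasRegularSubset_of_range
  have htrans : IsPretransitive (toPermHom S Ω).range Ω := isPretransitive_toPermHom_range
  have hsolv := Group.isSolvable_of_surjective (toPermHom S Ω).rangeRestrict_surjective
  have hodd' := hodd.of_dvd_nat (Subgroup.card_range_dvd (toPermHom S Ω))
  refine hasRegularSubset_of_faithfulSMul hodd' fun B hB hne hlt hlt' => ⟨?_, ?_⟩
  · have := stabilizer_isPretransitive_of_isBlock hB
    exact ih _ hlt (hodd'.of_dvd_nat (Subgroup.card_subgroup_dvd_card _)) rfl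
  · exact ih _ hlt' hodd' rfl

end Actions

/-- (Gluck) Let `S` be a solvable group of odd order acting faithfully and
transitively on a finite set `Ω`. Then `S` has a regular orbit on the power set of `Ω`,
i.e. there is a subset `Δ ⊆ Ω` whose setwise stabilizer in `S` is trivial. -/
theorem stmt_9 (S Ω : Type*) [Group S] [Finite Ω] [MulAction S Ω] [FaithfulSMul S Ω]
    (hsolv : IsSolvable S) (hodd : Odd (Nat.card S))
    (htrans : MulAction.IsPretransitive S Ω) :
    ∃ Δ : Set Ω, ∀ s : S, s • Δ = Δ → s = 1 := by
  have : Group.IsSolvable S := hsolv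
  have hsolv' := Group.isSolvable_of_surjective (MulAction.toPermHom S Ω).rangeRestrict_surjective
  have htrans' : MulAction.IsPretransitive (MulAction.toPermHom S Ω).range Ω :=
    isPretransitive_toPermHom_range
  obtain ⟨Δ, hΔ⟩ := hasRegularSubset_of_range (hasRegularSubset_of_isSolvable_of_odd
    (hodd.of_dvd_nat (Subgroup.card_range_dvd (MulAction.toPermHom S Ω))))
  refine ⟨Δ, fun s hs => FaithfulSMul.eq_of_smul_eq_smul (α := Ω) fun x => ?_⟩
  rw [one_smul]
  refine hΔ s (fun y => ?_) x
  nth_rw 1 [← hs]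
  exact Set.smul_mem_smul_set_iff
end

section
/- Let q be a prime power, n a positive integer, and s an odd prime with s dividing n and s dividing q^{n/s} − 1. Then Γ(q^n) contains elementary abelian subgroups of order s², any two elementary abelian subgroups of order s² of Γ(q^n) are conjugate in Γ(q^n), and their number equals the s'-part of (q^n − 1)/(q^{n/s} − 1). -/
open SemidirectProduct

section SemidirectProduct

variable {A H : Type*} [CommGroup A] [Group H] {φ : H →* MulAut A} {r s : ℕ} {τ : H}

theorem apply_eq_self_of_mem_zpowers {c : A} (hc : φ τ c = c) {σ : H}
    (hσ : σ ∈ Subgroup.zpowers τ) : φ σ c = c := by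
  have h : Subgroup.zpowers τ ≤ (MulAction.stabilizer (MulAut A) c).comap φ :=
    (Subgroup.zpowers_le).2 (by simpa [MulAction.mem_stabilizer_iff] using hc)
  simpa [MulAction.mem_stabilizer_iff] using h hσ

theorem pow_eq_self_of_dvd_sub_one {M : Type*} [Monoid M] (hr : 0 < r) (hsr : s ∣ r - 1) {z : M}
    (hz : z ^ s = 1) : z ^ r = z := by
  obtain ⟨k, hk⟩ := hsr
  rw [← Nat.sub_add_cancel hr, hk, pow_succ, pow_mul, hz, one_pow, one_mul]

theorem left_pow_of_apply_eq_pow {g : A ⋊[φ] H} (hg : ∀ a, φ g.right a = a ^ r) (k : ℕ) :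
    (g ^ k).left = g.left ^ (∑ i ∈ Finset.range k, r ^ i) := by
  induction k with
  | zero => simp
  | succ k ih =>
    rw [pow_succ', mul_left, hg, ih, geom_sum_succ, pow_succ', ← pow_mul, mul_comm r]

theorem left_conj_inl (b : A) (g : A ⋊[φ] H) :
    (inl b * g * (inl b)⁻¹).left = b * g.left * (φ g.right b)⁻¹ := by
  simp

theorem right_conj_inl (b : A) (g : A ⋊[φ] H) : (inl b * g * (inl b)⁻¹).right = g.right := by
  simp

variable (φ s τ) in
/-- The subgroup of `A ⋊[φ] H` of all pairs of an element of `A` killed by `s` and a power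
of `τ`. -/
def torsionSemidirect : Subgroup (A ⋊[φ] H) where
  carrier := {g | g.left ^ s = 1 ∧ g.right ∈ Subgroup.zpowers τ}
  one_mem' := by simp
  mul_mem' {g h} hg hh := by
    refine ⟨?_, mul_mem hg.2 hh.2⟩
    rw [mul_left, mul_pow, hg.1, ← map_pow, hh.1, map_one, one_mul]
  inv_mem' {g} hg := by
    refine ⟨?_, inv_mem hg.2⟩
    rw [inv_left, ← map_pow, inv_pow, hg.1, inv_one, map_one]

theorem mem_torsionSemidirect {g : A ⋊[φ] H} :
    g ∈ torsionSemidirect φ s τ ↔ g.left ^ s = 1 ∧ g.right ∈ Subgroup.zpowers τ :=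
  Iff.rfl

theorem nonempty_torsionSemidirect_mulEquiv [Finite A] [IsCyclic A] (hs : s ∣ Nat.card A)
    (hr : 0 < r) (hsr : s ∣ r - 1) (hτ : ∀ a, φ τ a = a ^ r) (hord : orderOf τ = s) :
    Nonempty (torsionSemidirect φ s τ ≃* Multiplicative (ZMod s × ZMod s)) := by
  have hZ : Nat.card (powMonoidHom s : A →* A).ker = s := by
    rw [IsCyclic.card_powMonoidHom_ker, Nat.gcd_eq_right hs]
  have hT : Nat.card (Subgroup.zpowers τ) = s := by rw [Nat.card_zpowers, hord]
  have e₁ := zmodCyclicMulEquiv (inferInstance : IsCyclic (powMonoidHom s : A →* A).ker)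
  have e₂ := zmodCyclicMulEquiv (inferInstance : IsCyclic (Subgroup.zpowers τ))
  rw [hZ] at e₁
  rw [hT] at e₂
  have e₃ : torsionSemidirect φ s τ ≃*
      (powMonoidHom s : A →* A).ker × Subgroup.zpowers τ :=
    { toFun := fun g ↦ (⟨g.1.left, g.2.1⟩, ⟨g.1.right, g.2.2⟩)
      invFun := fun p ↦ ⟨⟨p.1, p.2⟩, p.1.2, p.2.2⟩
      left_inv := fun g ↦ rfl
      right_inv := fun p ↦ rfl
      map_mul' := by
        rintro ⟨g, hg⟩ ⟨h, hh⟩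
        have : φ g.right h.left = h.left :=
          apply_eq_self_of_mem_zpowers (by
            rw [hτ, pow_eq_self_of_dvd_sub_one hr hsr hh.1]) hg.2
        ext <;> simp [this] }
  exact ⟨e₃.trans ((e₁.symm.prodCongr e₂.symm).trans
    (MulEquiv.prodMultiplicative (ZMod s) (ZMod s)).symm)⟩

theorem Subgroup.natCard_of_mulEquiv_zmod_prod {G : Type*} [Group G] {P : Subgroup G}
    (e : P ≃* Multiplicative (ZMod s × ZMod s)) : Nat.card P = s * s := by
  rw [Nat.card_congr e.toEquiv, Nat.card_congr Multiplicative.toAdd, Nat.card_prod, Nat.card_zmod]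

theorem Subgroup.pow_eq_one_of_mulEquiv_zmod_prod {G : Type*} [Group G] {P : Subgroup G}
    (e : P ≃* Multiplicative (ZMod s × ZMod s)) {g : G} (hg : g ∈ P) : g ^ s = 1 := by
  have h : (⟨g, hg⟩ : P) ^ s = 1 := by
    apply e.injective
    rw [map_pow, map_one]
    apply Multiplicative.toAdd.injective
    rw [toAdd_pow, toAdd_one]
    ext <;> simp
  simpa using congrArg Subtype.val h

theorem Subgroup.map_conj_mulEquiv {G M : Type*} [Group G] [Mul M] {P : Subgroup G} (g : G)
    (h : Nonempty (P ≃* M)) : Nonempty (P.map (MulAut.conj g).toMonoidHom ≃* M) :=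
  h.map fun e ↦ ((MulAut.conj g).subgroupMap P).symm.trans e

theorem IsCyclic.exists_pow_eq_of_pow_eq_one [Finite A] [IsCyclic A] {m d : ℕ}
    (hm : 0 < m) (hcard : Nat.card A = m * d) {a : A} (ha : a ^ m = 1) : ∃ c : A, c ^ d = a := by
  obtain ⟨g, hg⟩ := IsCyclic.exists_monoid_generator (α := A)
  obtain ⟨i, rfl⟩ := hg a
  have hord : orderOf g = m * d := by
    rw [← hcard]
    exact orderOf_eq_card_of_forall_mem_zpowers fun x ↦ Submonoid.powers_le_zpowers g (hg x)
  rw [← pow_mul] at ha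
  have h := orderOf_dvd_of_pow_eq_one ha
  rw [hord, mul_comm i] at h
  obtain ⟨k, rfl⟩ := Nat.dvd_of_mul_dvd_mul_left hm h
  exact ⟨g ^ k, by rw [← pow_mul, mul_comm]⟩

theorem exists_right_ne_one [Finite A] [IsCyclic A] (hs : s.Prime) {P : Subgroup (A ⋊[φ] H)}
    (e : P ≃* Multiplicative (ZMod s × ZMod s)) : ∃ g ∈ P, g.right ≠ 1 := by
  by_contra! h
  have hinj : Function.Injective fun g : P ↦
      (⟨g.1.left, by
        have hg : g.1 = inl g.1.left := SemidirectProduct.ext rfl (h g.1 g.2)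
        have hp := Subgroup.pow_eq_one_of_mulEquiv_zmod_prod e g.2
        rw [hg, ← map_pow] at hp
        exact inl_injective (hp.trans (map_one inl).symm)⟩ : (powMonoidHom s : A →* A).ker) := by
    intro g g' hgg
    exact Subtype.ext (SemidirectProduct.ext (congrArg Subtype.val hgg)
      ((h g.1 g.2).trans (h g'.1 g'.2).symm))
  have hle := Nat.card_le_card_of_injective _ hinj
  rw [IsCyclic.card_powMonoidHom_ker, Subgroup.natCard_of_mulEquiv_zmod_prod e] at hle
  have := Nat.gcd_le_right (Nat.card A) hs.pos
  nlinarith [hs.two_le]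

theorem exists_mem_right_eq [Finite A] [IsCyclic A] (hs : s.Prime) (hord : orderOf τ = s)
    (hT : ∀ σ : H, σ ^ s = 1 → σ ∈ Subgroup.zpowers τ) {P : Subgroup (A ⋊[φ] H)}
    (e : P ≃* Multiplicative (ZMod s × ZMod s)) : ∃ g ∈ P, g.right = τ := by
  obtain ⟨g, hg, hne⟩ := exists_right_ne_one hs e
  have hgT : g.right ∈ Subgroup.zpowers τ := hT _ (by
    rw [← rightHom_eq_right, ← map_pow, Subgroup.pow_eq_one_of_mulEquiv_zmod_prod e hg, map_one])
  have : Fact s.Prime := ⟨hs⟩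
  have hcard : Nat.card (Subgroup.zpowers τ) = s := by rw [Nat.card_zpowers, hord]
  obtain ⟨k, hk⟩ := Subgroup.mem_zpowers_iff.1 <| mem_zpowers_of_prime_card hcard
    (g := ⟨g.right, hgT⟩) (g' := ⟨τ, Subgroup.mem_zpowers τ⟩)
    fun h ↦ hne (congrArg Subtype.val h)
  refine ⟨g ^ k, zpow_mem hg k, ?_⟩
  rw [← rightHom_eq_right, map_zpow]
  simpa using congrArg Subtype.val hk

theorem eq_torsionSemidirect_of_inr_mem (hs : s.Prime)
    (hT : ∀ σ : H, σ ^ s = 1 → σ ∈ Subgroup.zpowers τ)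
    (hstd : Nonempty (torsionSemidirect φ s τ ≃* Multiplicative (ZMod s × ZMod s)))
    {P : Subgroup (A ⋊[φ] H)} (e : P ≃* Multiplicative (ZMod s × ZMod s)) (hτP : inr τ ∈ P) :
    P = torsionSemidirect φ s τ := by
  obtain ⟨e'⟩ := hstd
  have hcard := Subgroup.natCard_of_mulEquiv_zmod_prod e'
  have : Finite (torsionSemidirect φ s τ) :=
    Nat.finite_of_card_ne_zero (by rw [hcard]; exact (Nat.mul_pos hs.pos hs.pos).ne')
  refine Subgroup.eq_of_le_of_card_ge (fun g hg ↦ ?_)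
    (by rw [hcard, Subgroup.natCard_of_mulEquiv_zmod_prod e])
  have hgT : g.right ∈ Subgroup.zpowers τ := hT _ (by
    rw [← rightHom_eq_right, ← map_pow, Subgroup.pow_eq_one_of_mulEquiv_zmod_prod e hg, map_one])
  refine ⟨?_, hgT⟩
  obtain ⟨k, hk⟩ := hgT
  have hl : (inl g.left : A ⋊[φ] H) ∈ P := by
    have h := mul_mem hg (inv_mem (zpow_mem hτP k))
    rwa [← map_zpow, show τ ^ k = g.right from hk,
      mul_inv_eq_iff_eq_mul.2 (inl_left_mul_inr_right g).symm] at h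
  have hp := Subgroup.pow_eq_one_of_mulEquiv_zmod_prod e hl
  rw [← map_pow] at hp
  exact inl_injective (hp.trans (map_one inl).symm)

theorem exists_eq_map_conj_inl [Finite A] [IsCyclic A] (hs : s.Prime) (hr : 0 < r)
    (hcard : Nat.card A = (∑ i ∈ Finset.range s, r ^ i) * (r - 1))
    (hτ : ∀ a, φ τ a = a ^ r) (hord : orderOf τ = s)
    (hT : ∀ σ : H, σ ^ s = 1 → σ ∈ Subgroup.zpowers τ)
    (hstd : Nonempty (torsionSemidirect φ s τ ≃* Multiplicative (ZMod s × ZMod s)))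
    {P : Subgroup (A ⋊[φ] H)} (e : P ≃* Multiplicative (ZMod s × ZMod s)) :
    ∃ b : A, P = (torsionSemidirect φ s τ).map (MulAut.conj (inl b)).toMonoidHom := by
  obtain ⟨g, hg, hgτ⟩ := exists_mem_right_eq hs hord hT e
  have hM : g.left ^ (∑ i ∈ Finset.range s, r ^ i) = 1 := by
    rw [← left_pow_of_apply_eq_pow (by rwa [hgτ]),
      Subgroup.pow_eq_one_of_mulEquiv_zmod_prod e hg, one_left]
  have hMpos : 0 < ∑ i ∈ Finset.range s, r ^ i :=
    Finset.sum_pos (fun i _ ↦ pow_pos hr i) (Finset.nonempty_range_iff.2 hs.ne_zero)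
  obtain ⟨c, hc⟩ := IsCyclic.exists_pow_eq_of_pow_eq_one hMpos hcard hM
  have hcr : c ^ r = g.left * c := by
    rw [← hc, ← pow_succ, Nat.sub_add_cancel hr]
  have hconj : inl c * g * (inl c)⁻¹ = inr τ := by
    ext
    · rw [left_conj_inl, hgτ, hτ, hcr, left_inr, mul_comm c, mul_inv_cancel]
    · rw [right_conj_inl, hgτ, right_inr]
  obtain ⟨e'⟩ := Subgroup.map_conj_mulEquiv (inl c) ⟨e⟩
  have h := eq_torsionSemidirect_of_inr_mem hs hT hstd e' ⟨g, hg, hconj⟩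
  refine ⟨c⁻¹, ?_⟩
  rw [← h, Subgroup.map_map]
  ext x
  simp [mul_assoc]

theorem map_conj_inl_torsionSemidirect_eq_iff [Finite (torsionSemidirect φ s τ)] (hr : 0 < r)
    (hτ : ∀ a, φ τ a = a ^ r) (b : A) :
    (torsionSemidirect φ s τ).map (MulAut.conj (inl b)).toMonoidHom = torsionSemidirect φ s τ ↔
      b ^ ((r - 1) * s) = 1 := by
  have key : b ^ ((r - 1) * s) = 1 ↔ φ τ (b ^ s) = b ^ s := by
    rw [hτ, mul_comm, pow_mul, ← mul_left_inj (b ^ s), ← pow_succ, Nat.sub_add_cancel hr, one_mul]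
  rw [key]
  constructor
  · intro h
    have hmem : inr τ ∈ torsionSemidirect φ s τ := ⟨by simp, Subgroup.mem_zpowers τ⟩
    have h' : inl b * inr τ * (inl b)⁻¹ ∈ torsionSemidirect φ s τ := by
      rw [← h]
      exact ⟨_, hmem, rfl⟩
    have h₁ := h'.1
    rw [left_conj_inl, left_inr, right_inr, mul_one, mul_pow, inv_pow, ← map_pow,
      mul_inv_eq_one] at h₁
    exact h₁.symm
  · intro h
    refine Subgroup.eq_of_le_of_card_ge ?_ ?_
    · rintro _ ⟨g, hg, rfl⟩
      change inl b * g * (inl b)⁻¹ ∈ _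
      refine ⟨?_, by rw [right_conj_inl]; exact hg.2⟩
      rw [left_conj_inl, mul_pow, mul_pow, hg.1, inv_pow, ← map_pow,
        apply_eq_self_of_mem_zpowers h hg.2, mul_one, mul_inv_cancel]
    · exact (Nat.card_congr ((MulAut.conj (inl b)).subgroupMap _).toEquiv).le

theorem natCard_elementaryAbelian [Finite A] [IsCyclic A] (hs : s.Prime) (hr : 0 < r)
    (hcard : Nat.card A = (∑ i ∈ Finset.range s, r ^ i) * (r - 1))
    (hτ : ∀ a, φ τ a = a ^ r) (hord : orderOf τ = s)
    (hT : ∀ σ : H, σ ^ s = 1 → σ ∈ Subgroup.zpowers τ)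
    (hstd : Nonempty (torsionSemidirect φ s τ ≃* Multiplicative (ZMod s × ZMod s))) :
    Nat.card {P : Subgroup (A ⋊[φ] H) // Nonempty (P ≃* Multiplicative (ZMod s × ZMod s))} =
      Nat.card A / (Nat.card A).gcd ((r - 1) * s) := by
  rw [← IsCyclic.index_powMonoidHom_ker, Subgroup.index]
  have : Finite (torsionSemidirect φ s τ) := by
    obtain ⟨e⟩ := hstd
    refine Nat.finite_of_card_ne_zero ?_
    rw [Subgroup.natCard_of_mulEquiv_zmod_prod e]
    exact (Nat.mul_pos hs.pos hs.pos).ne'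
  let f : A → {P : Subgroup (A ⋊[φ] H) // Nonempty (P ≃* Multiplicative (ZMod s × ZMod s))} :=
    fun b ↦ ⟨_, Subgroup.map_conj_mulEquiv (inl b) hstd⟩
  have hf : ∀ b c, f b = f c ↔ b⁻¹ * c ∈ (powMonoidHom ((r - 1) * s) : A →* A).ker := by
    intro b c
    rw [MonoidHom.mem_ker, powMonoidHom_apply, ← map_conj_inl_torsionSemidirect_eq_iff hr hτ,
      Subtype.ext_iff]
    have hcomp : (MulAut.conj (inl c : A ⋊[φ] H)).toMonoidHom =
        (MulAut.conj (inl b)).toMonoidHom.comp (MulAut.conj (inl (b⁻¹ * c))).toMonoidHom := by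
      ext x <;> simp [mul_assoc]
    change _ = Subgroup.map _ _ ↔ _
    rw [hcomp, ← Subgroup.map_map, eq_comm]
    exact (Subgroup.map_injective (MulAut.conj (inl b)).injective).eq_iff
  refine (Nat.card_congr (Equiv.ofBijective
    (Quotient.lift f fun b c h ↦ (hf b c).2 (QuotientGroup.leftRel_apply.1 h)) ⟨?_, ?_⟩)).symm
  · rintro ⟨b⟩ ⟨c⟩ h
    exact Quotient.sound (QuotientGroup.leftRel_apply.2 ((hf b c).1 h))
  · rintro ⟨P, ⟨e⟩⟩
    obtain ⟨b, hb⟩ := exists_eq_map_conj_inl hs hr hcard hτ hord hT hstd e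
    exact ⟨QuotientGroup.mk b, Subtype.ext hb.symm⟩

end SemidirectProduct

theorem Nat.geom_sum_factorization_eq_one {r s : ℕ} (hs : s.Prime) (hsodd : Odd s) (hr : 1 < r)
    (hsr : s ∣ r - 1) : (∑ i ∈ Finset.range s, r ^ i).factorization s = 1 := by
  have : Fact s.Prime := ⟨hs⟩
  have hnd : ¬ s ∣ r := fun h ↦ hs.one_lt.ne' <| Nat.dvd_one.1 <| by
    simpa [Nat.sub_sub_self hr.le] using Nat.dvd_sub h hsr
  have h := padicValNat.pow_sub_pow hsodd hr hsr hnd hs.ne_zero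
  have hpos : 0 < ∑ i ∈ Finset.range s, r ^ i :=
    Finset.sum_pos (fun i _ ↦ pow_pos (by lia) i) (Finset.nonempty_range_iff.2 hs.ne_zero)
  have hgeom : (∑ i ∈ Finset.range s, r ^ i) * (r - 1) = r ^ s - 1 := by
    rw [Nat.geomSum_eq hr, Nat.div_mul_cancel (by simpa using Nat.sub_dvd_pow_sub_pow r 1 s)]
  rw [one_pow, ← hgeom, padicValNat.mul hpos.ne' (by lia), padicValNat_self] at h
  rw [Nat.factorization_def _ hs]
  lia

theorem FiniteField.mem_zpowers_frobenius_pow {F K : Type*} [Field F] [Field K] [Fintype F]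
    [Finite K] [Algebra F K] {s : ℕ} (hs : 0 < s) (hsn : s ∣ Module.finrank F K)
    {σ : K ≃ₐ[F] K} (hσ : σ ^ s = 1) :
    σ ∈ Subgroup.zpowers (frobeniusAlgEquivOfAlgebraic F K ^ (Module.finrank F K / s)) := by
  obtain ⟨k, rfl⟩ := (bijective_frobeniusAlgEquivOfAlgebraic_pow F K).2 σ
  simp only at hσ ⊢
  rw [← pow_mul] at hσ
  have h := orderOf_dvd_of_pow_eq_one hσ
  rw [orderOf_frobeniusAlgEquivOfAlgebraic] at h
  nth_rw 1 [← Nat.div_mul_cancel hsn] at h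
  obtain ⟨j, hj⟩ := Nat.dvd_of_mul_dvd_mul_right hs h
  rw [hj, pow_mul]
  exact Subgroup.npow_mem_zpowers _ _

/-- Let `q` be a prime power, `n ≥ 1`, and `s` an odd prime with `s ∣ n`
and `s ∣ q^{n/s} - 1`.  Then `Γ(q^n)` contains elementary abelian subgroups of order `s²`
(i.e. subgroups isomorphic to `Z_s × Z_s`), any two such subgroups are conjugate in
`Γ(q^n)`, and their number equals the `s'`-part of `M = (q^n - 1)/(q^{n/s} - 1)`, i.e. `M / s ^ (M.factorization s)`.

`Γ(q^n)` is modelled by the abstractly isomorphic group `Kˣ ⋊[galAct F K] (K ≃ₐ[F] K)`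
for finite fields `F ⊆ K` with `|F| = q`, `|K| = q^n`. -/
theorem stmt_12 (F K : Type*) [Field F] [Field K] [Fintype F] [Fintype K] [Algebra F K]
    (q n s : ℕ) (hq : Fintype.card F = q) (hK : Fintype.card K = q ^ n) (hn : 0 < n)
    (hs : s.Prime) (hsodd : Odd s) (hsn : s ∣ n) (hsq : s ∣ q ^ (n / s) - 1) :
    (∃ P : Subgroup (Kˣ ⋊[galAct F K] (K ≃ₐ[F] K)),
        Nonempty (P ≃* Multiplicative (ZMod s × ZMod s))) ∧
    (∀ P Q : Subgroup (Kˣ ⋊[galAct F K] (K ≃ₐ[F] K)),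
        Nonempty (P ≃* Multiplicative (ZMod s × ZMod s)) →
        Nonempty (Q ≃* Multiplicative (ZMod s × ZMod s)) →
        ∃ g : Kˣ ⋊[galAct F K] (K ≃ₐ[F] K), Q = P.map (MulAut.conj g).toMonoidHom) ∧
    Nat.card {P : Subgroup (Kˣ ⋊[galAct F K] (K ≃ₐ[F] K)) //
        Nonempty (P ≃* Multiplicative (ZMod s × ZMod s))} =
      ((q ^ n - 1) / (q ^ (n / s) - 1)) / s ^ ((q ^ n - 1) / (q ^ (n / s) - 1)).factorization s := by
  have hq1 : 1 < q := hq ▸ Fintype.one_lt_card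
  have hfr : Module.finrank F K = n := by
    apply Nat.pow_right_injective hq1
    simp only
    rw [← hK, ← hq, Module.card_eq_pow_finrank (K := F) (V := K)]
  have hns : 0 < n / s := Nat.div_pos (Nat.le_of_dvd hn hsn) hs.pos
  set r := q ^ (n / s) with hrdef
  have hr1 : 1 < r := Nat.one_lt_pow hns.ne' hq1
  have hr : 0 < r := by lia
  have hqn : q ^ n = r ^ s := by rw [hrdef, ← pow_mul, Nat.div_mul_cancel hsn]
  have hM : (q ^ n - 1) / (r - 1) = ∑ i ∈ Finset.range s, r ^ i := by
    rw [hqn, Nat.geomSum_eq hr1]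
  have hcard : Nat.card Kˣ = (∑ i ∈ Finset.range s, r ^ i) * (r - 1) := by
    rw [Nat.card_units, Nat.card_eq_fintype_card, hK, ← hM, Nat.div_mul_cancel]
    simpa [hqn] using Nat.sub_dvd_pow_sub_pow r 1 s
  let τ : K ≃ₐ[F] K := FiniteField.frobeniusAlgEquivOfAlgebraic F K ^ (n / s)
  have hτ : ∀ a, galAct F K τ a = a ^ r := by
    intro a
    ext
    change τ (a : K) = _
    rw [AlgEquiv.coe_pow, FiniteField.coe_frobeniusAlgEquivOfAlgebraic_iterate, hq,
      Units.val_pow_eq_pow_val]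
  have hord : orderOf τ = s := by
    rw [orderOf_pow_of_dvd hns.ne' (by
        rw [FiniteField.orderOf_frobeniusAlgEquivOfAlgebraic, hfr]; exact Nat.div_dvd_of_dvd hsn),
      FiniteField.orderOf_frobeniusAlgEquivOfAlgebraic, hfr, Nat.div_div_self hsn hn.ne']
  have hT : ∀ σ : K ≃ₐ[F] K, σ ^ s = 1 → σ ∈ Subgroup.zpowers τ := by
    intro σ hσ
    have h := FiniteField.mem_zpowers_frobenius_pow hs.pos (hfr ▸ hsn) hσ
    rwa [hfr] at h
  have hstd := nonempty_torsionSemidirect_mulEquiv (φ := galAct F K)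
    (hcard ▸ hsq.mul_left _) hr hsq hτ hord
  have hfac := Nat.geom_sum_factorization_eq_one hs hsodd hr1 hsq
  refine ⟨⟨_, hstd⟩, ?_, ?_⟩
  · rintro P Q ⟨eP⟩ ⟨eQ⟩
    obtain ⟨b, rfl⟩ := exists_eq_map_conj_inl hs hr hcard hτ hord hT hstd eP
    obtain ⟨c, rfl⟩ := exists_eq_map_conj_inl hs hr hcard hτ hord hT hstd eQ
    refine ⟨inl (c * b⁻¹), ?_⟩
    rw [Subgroup.map_map]
    congr 1
    ext x <;> simp [mul_assoc]
  · have hsM : s ∣ ∑ i ∈ Finset.range s, r ^ i :=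
      Nat.dvd_of_factorization_pos (by rw [hfac]; exact one_ne_zero)
    rw [natCard_elementaryAbelian hs hr hcard hτ hord hT hstd, hM, hfac, pow_one, hcard,
      mul_comm (r - 1), Nat.gcd_eq_right (Nat.mul_dvd_mul_right hsM _),
      Nat.mul_div_mul_right _ _ (by lia)]
end

section
/- Let G be a finite group of odd order acting linearly on a vector space V over a field of odd characteristic, and let v ∈ V with v ≠ 0. Then −v does not lie in the G-orbit of v; in particular, the nontrivial G-orbits on V are paired off by v^G ↔ (−v)^G with |v^G| = |(−v)^G|. -/
/-- If `g` negates `v`, then `g ^ n` acts on `v` as `(-1) ^ n`. -/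
theorem pow_smul_of_smul_eq_neg {G V : Type*} [Monoid G] [AddCommGroup V]
    [DistribMulAction G V] {g : G} {v : V} (h : g • v = -v) (n : ℕ) :
    g ^ n • v = (-1 : ℤ) ^ n • v := by
  induction n with
  | zero => simp
  | succ n ih => rw [pow_succ, mul_smul, h, smul_neg, ih, pow_succ, mul_neg_one, neg_smul]

/-- Negation is a bijection from the orbit of `v` to the orbit of `-v`. -/
theorem neg_image_orbit {G V : Type*} [Monoid G] [AddCommGroup V]
    [DistribMulAction G V] (v : V) :
    Neg.neg '' MulAction.orbit G v = MulAction.orbit G (-v) := by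
  simp only [MulAction.orbit, ← Set.range_comp, Function.comp_def, smul_neg]

/-- Let `G` be a finite group of odd order acting linearly on a vector
space `V` over a field of odd characteristic, and let `v ∈ V`, `v ≠ 0`. Then `-v` does not
lie in the `G`-orbit of `v`; in particular the nontrivial orbits are paired `v^G ↔ (-v)^G`
with `|v^G| = |(-v)^G|`. -/
theorem stmt_13 {G F V : Type*} [Group G] [Field F] [AddCommGroup V] [Module F V]
    [DistribMulAction G V] [SMulCommClass G F V]
    (hodd : Odd (Nat.card G)) (hchar : Odd (ringChar F))
    (v : V) (hv : v ≠ 0) :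
    -v ∉ MulAction.orbit G v ∧
      Nat.card (MulAction.orbit G v) = Nat.card (MulAction.orbit G (-v)) := by
  refine ⟨?_, ?_⟩
  · rintro ⟨g, hg⟩
    have h := pow_smul_of_smul_eq_neg hg (Nat.card G)
    rw [pow_card_eq_one', one_smul, hodd.neg_one_pow, neg_one_smul] at h
    have h2 : (2 : F) ≠ 0 := Ring.two_ne_zero fun h => by simp [h, Nat.odd_iff] at hchar
    have h3 : (2 : F) • v = 0 := by rw [two_smul]; exact eq_neg_iff_add_eq_zero.mp h
    exact (smul_ne_zero h2 hv) h3
  · rw [← neg_image_orbit, Nat.card_image_of_injective neg_injective]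
end

section
/- Let s be a prime dividing n, let σ ∈ Gal(q^n) be of order s, set N_s = {x ∈ F(q^n) : N_σ(x) = 1}, and let B be a subgroup of F(q^n). Then T = {x ∈ F(q^n) : σ(x)/x ∈ B} is a subgroup of F(q^n), and T is a proper subgroup of F(q^n) if and only if N_s is not contained in B. -/
/-- The homomorphism `x ↦ σ x / x` on the units of a field. -/
noncomputable def AlgEquiv.unitsDivHom {F K : Type*} [Field F] [Field K] [Algebra F K]
    (σ : K ≃ₐ[F] K) : Kˣ →* Kˣ :=
  Units.map (σ : K →* K) / MonoidHom.id Kˣ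

theorem AlgEquiv.coe_unitsDivHom {F K : Type*} [Field F] [Field K] [Algebra F K]
    (σ : K ≃ₐ[F] K) (x : Kˣ) : (σ.unitsDivHom x : K) = σ (x : K) / (x : K) := by
  simp [AlgEquiv.unitsDivHom, MonoidHom.div_apply]

theorem AlgEquiv.prod_pow_div_self {F K : Type*} [Field F] [Field K] [Algebra F K]
    (σ : K ≃ₐ[F] K) {x : K} (hx : x ≠ 0) :
    ∏ i ∈ Finset.range (orderOf σ), (σ ^ i) (σ x / x) = 1 := by
  have hne (i : ℕ) : (σ ^ i) x ≠ 0 := (map_ne_zero (σ ^ i)).2 hx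
  have h (m : ℕ) : ∏ i ∈ Finset.range m, (σ ^ i) (σ x / x) = (σ ^ m) x / x := by
    induction m with
    | zero => simp [hx]
    | succ m ih =>
      rw [Finset.prod_range_succ, ih, map_div₀, pow_succ, AlgEquiv.mul_apply]
      rw [div_mul_div_comm, mul_comm x, mul_div_mul_left _ _ (hne m)]
  rw [h, pow_orderOf_eq_one, AlgEquiv.one_apply, div_self hx]

/-- Hilbert's Theorem 90 for a single automorphism of finite order. -/
theorem AlgEquiv.exists_eq_mul_of_prod_pow_eq_one {F K : Type*} [Field F] [Field K] [Algebra F K]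
    (σ : K ≃ₐ[F] K) (hσ : 0 < orderOf σ) {x : K}
    (hx : ∏ i ∈ Finset.range (orderOf σ), (σ ^ i) x = 1) :
    ∃ y : K, y ≠ 0 ∧ σ y = x * y := by
  set c : ℕ → K := fun i => ∏ j ∈ Finset.range i, (σ ^ j) x with hc
  have hc_succ (i : ℕ) : x * σ (c i) = c (i + 1) := by
    simp only [hc, map_prod]
    rw [Finset.prod_range_succ']
    simp [pow_succ', mul_comm]
  have hli : LinearIndependent K fun i : Fin (orderOf σ) =>
      (((σ ^ (i : ℕ) : K ≃ₐ[F] K) : K →* K) : K → K) := by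
    refine (linearIndependent_monoidHom K K).comp
      (fun i : Fin (orderOf σ) => ((σ ^ (i : ℕ) : K ≃ₐ[F] K) : K →* K)) fun i j hij => ?_
    refine Fin.ext (pow_injOn_Iio_orderOf i.2 j.2 (AlgEquiv.ext fun a => ?_))
    exact DFunLike.congr_fun hij a
  obtain ⟨z, hz⟩ : ∃ z, ∑ i ∈ Finset.range (orderOf σ), c i * (σ ^ i) z ≠ 0 := by
    by_contra! h
    have h0 := Fintype.linearIndependent_iff.1 hli (fun i => c i) (by
      ext z
      simpa [Finset.sum_range] using h z) ⟨0, hσ⟩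
    simp [hc] at h0
  set w := ∑ i ∈ Finset.range (orderOf σ), c i * (σ ^ i) z with hw
  have hxw : x * σ w = w := by
    have h1 : x * σ w = ∑ i ∈ Finset.range (orderOf σ), c (i + 1) * (σ ^ (i + 1)) z := by
      simp only [hw, map_sum, Finset.mul_sum, map_mul, ← hc_succ, pow_succ', AlgEquiv.mul_apply,
        mul_assoc]
    have h2 := Finset.sum_range_succ (fun i => c i * (σ ^ i) z) (orderOf σ)
    rw [Finset.sum_range_succ'] at h2
    have h3 : c (orderOf σ) = 1 := hx
    have h4 : c 0 = 1 := by simp [hc]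
    rw [h3, h4, pow_orderOf_eq_one, pow_zero] at h2
    rw [h1]
    exact add_right_cancel h2
  refine ⟨w⁻¹, inv_ne_zero hz, ?_⟩
  have hσw : σ w ≠ 0 := by simpa using hz
  rw [map_inv₀, inv_eq_iff_eq_inv, mul_inv, inv_inv]
  have hx0 : x ≠ 0 := by
    rintro rfl
    exact hz (by simpa using hxw.symm)
  rw [← hxw, inv_mul_cancel_left₀ hx0, hxw]

/-- Let `s` be a prime dividing `n`, `σ ∈ Gal(q^n)` of order `s`,
`N_s = {x ∈ F(q^n) : N_σ(x) = 1}`, and let `B ≤ F(q^n)` be a subgroup.  Then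
`T = {x ∈ F(q^n) : σ(x)/x ∈ B}` is a subgroup of `F(q^n)`, and `T` is proper iff
`N_s ⊄ B`.

Here `F(q^n) = Kˣ` for a finite field `K` with `|K| = q^n` containing `F` with `|F| = q`;
`σ(x)/x ∈ B` is expressed as `∃ b ∈ B, σ(x) = b * x`, and `N_σ(x) = ∏_{i<s} σ^i(x)`. -/
theorem stmt_15 (F K : Type*) [Field F] [Field K] [Fintype F] [Fintype K] [Algebra F K]
    (q n s : ℕ) (hq : Fintype.card F = q) (hK : Fintype.card K = q ^ n)
    (hs : s.Prime) (hsn : s ∣ n)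
    (σ : K ≃ₐ[F] K) (hσ : orderOf σ = s)
    (B : Subgroup Kˣ) :
    ∃ T : Subgroup Kˣ,
      (T : Set Kˣ) = {x : Kˣ | ∃ b ∈ B, σ (x : K) = (b : K) * (x : K)} ∧
      (T ≠ ⊤ ↔ ¬ {x : Kˣ | ∏ i ∈ Finset.range s, (σ ^ i) (x : K) = 1} ⊆ (B : Set Kˣ)) := by
  refine ⟨B.comap σ.unitsDivHom, ?_, not_congr ?_⟩
  · ext x
    simp only [Subgroup.coe_comap, Set.mem_preimage, SetLike.mem_coe, Set.mem_ofPred_eq]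
    constructor
    · intro h
      exact ⟨_, h, by rw [AlgEquiv.coe_unitsDivHom, div_mul_cancel₀ _ x.ne_zero]⟩
    · rintro ⟨b, hb, h⟩
      have : σ.unitsDivHom x = b :=
        Units.ext (by rw [AlgEquiv.coe_unitsDivHom, h, mul_div_cancel_right₀ _ x.ne_zero])
      rwa [this]
  · subst hσ
    constructor
    · intro h x hx
      obtain ⟨y, hy, hyx⟩ := σ.exists_eq_mul_of_prod_pow_eq_one hs.pos hx
      have hmem : Units.mk0 y hy ∈ B.comap σ.unitsDivHom := h ▸ Subgroup.mem_top _
      have : σ.unitsDivHom (Units.mk0 y hy) = x :=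
        Units.ext (by rw [AlgEquiv.coe_unitsDivHom, Units.val_mk0, hyx, mul_div_cancel_right₀ _ hy])
      rwa [Subgroup.mem_comap, this] at hmem
    · intro h
      refine (Subgroup.eq_top_iff' _).2 fun x => h ?_
      simp only [Set.mem_ofPred_eq, AlgEquiv.coe_unitsDivHom]
      exact σ.prod_pow_div_self x.ne_zero
end
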